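/- arXiv:1002.2576 — 2 statements merged into one kernel-verified Lean document; each statement's English description precedes it below -/
import Mathlib

section
/- Let (C, X, ρ) be an R-matrix (ρ : X ⊗ X → X ⊗ X an isomorphism satisfying the Yang–Baxter equation) such that both ρ and ρ⁻¹ are X-left isomorphisms with respect to a duality p = ⟨X, Y, η, ε⟩. Then, setting ρ± = l_p(ρ^{±1}), the morphisms η̄ = ρ₋⁻¹ ∘ η : 𝟙 → X ⊗ Y and ε̄ = ε ∘ ρ₊⁻¹ : Y ⊗ X → 𝟙 satisfy the zig-zag identities (ε̄ ⊗ id_Y) ∘ (id_Y ⊗ η̄) = id_Y and (id_X ⊗ ε̄) ∘ (η̄ ⊗ id_X) = id_X, so ⟨Y, X, η̄, ε̄⟩ is a duality. In particular X is strongly rigid (it has both a left and a right dual, and its left dual Y is isomorphic to its right dual). -/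
open CategoryTheory MonoidalCategory

namespace Stmt4

variable {C : Type*} [Category C] [MonoidalCategory C]

/-- `l_p = a_p ∘ b_p⁻¹` for a duality `p = ⟨X, Y, η, ε⟩`. -/
def lp {X Y U V : C} (η : 𝟙_ C ⟶ Y ⊗ X) (ε : X ⊗ Y ⟶ 𝟙_ C)
    (f : X ⊗ U ⟶ V ⊗ X) : U ⊗ Y ⟶ Y ⊗ V :=
  (λ_ (U ⊗ Y)).inv ≫ η ▷ (U ⊗ Y) ≫ (α_ Y X (U ⊗ Y)).hom ≫
    Y ◁ ((α_ X U Y).inv ≫ f ▷ Y ≫ (α_ V X Y).hom ≫ V ◁ ε ≫ (ρ_ V).hom)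


section Core

variable {D : Type*} [Category D]

/-- functorial version of `lp` -/
def L (F G U V : D ⥤ D) (n : ∀ Z, Z ⟶ G.obj (F.obj Z)) (e : ∀ Z, F.obj (G.obj Z) ⟶ Z)
    (f : ∀ Z, F.obj (U.obj Z) ⟶ V.obj (F.obj Z)) (Z : D) : U.obj (G.obj Z) ⟶ G.obj (V.obj Z) :=
  n (U.obj (G.obj Z)) ≫ G.map (f (G.obj Z)) ≫ G.map (V.map (e Z))

variable {F G U V : D ⥤ D} {n : ∀ Z, Z ⟶ G.obj (F.obj Z)} {e : ∀ Z, F.obj (G.obj Z) ⟶ Z}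

theorem L_nat (hn : ∀ {A B : D} (f : A ⟶ B), f ≫ n B = n A ≫ G.map (F.map f))
    (he : ∀ {A B : D} (f : A ⟶ B), F.map (G.map f) ≫ e B = e A ≫ f)
    (f : ∀ Z, F.obj (U.obj Z) ⟶ V.obj (F.obj Z))
    (hf : ∀ {A B : D} (g : A ⟶ B), F.map (U.map g) ≫ f B = f A ≫ V.map (F.map g))
    {A B : D} (g : A ⟶ B) :
    U.map (G.map g) ≫ L F G U V n e f B = L F G U V n e f A ≫ G.map (V.map g) := by
  unfold L
  rw [← Category.assoc, hn, Category.assoc]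
  simp only [Category.assoc, ← G.map_comp, ← V.map_comp, ← he]
  rw [← Category.assoc (F.map _), hf, Category.assoc, V.map_comp]

theorem L_eq1 (he : ∀ {A B : D} (f : A ⟶ B), F.map (G.map f) ≫ e B = e A ≫ f)
    (t1 : ∀ Z, F.map (n Z) ≫ e (F.obj Z) = 𝟙 _)
    (f : ∀ Z, F.obj (U.obj Z) ⟶ V.obj (F.obj Z)) (Z : D) :
    F.map (L F G U V n e f Z) ≫ e (V.obj Z) = f (G.obj Z) ≫ V.map (e Z) := by
  unfold L
  rw [← G.map_comp, F.map_comp, Category.assoc, he, ← Category.assoc, t1, Category.id_comp]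

theorem L_eq2 (hn : ∀ {A B : D} (f : A ⟶ B), f ≫ n B = n A ≫ G.map (F.map f))
    (t1 : ∀ Z, F.map (n Z) ≫ e (F.obj Z) = 𝟙 _)
    (f : ∀ Z, F.obj (U.obj Z) ⟶ V.obj (F.obj Z))
    (hf : ∀ {A B : D} (g : A ⟶ B), F.map (U.map g) ≫ f B = f A ≫ V.map (F.map g)) (Z : D) :
    U.map (n Z) ≫ L F G U V n e f (F.obj Z) = n (U.obj Z) ≫ G.map (f Z) := by
  unfold L
  rw [← Category.assoc, hn, Category.assoc, ← G.map_comp, ← G.map_comp, ← Category.assoc (F.map _),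
    hf, Category.assoc, ← V.map_comp, t1, V.map_id, Category.comp_id]

theorem F_inj (hn : ∀ {A B : D} (f : A ⟶ B), f ≫ n B = n A ≫ G.map (F.map f))
    (t2 : ∀ Z, n (G.obj Z) ≫ G.map (e Z) = 𝟙 _) {A B : D} {h h' : A ⟶ G.obj B}
    (H : F.map h ≫ e B = F.map h' ≫ e B) : h = h' := by
  have key : ∀ k : A ⟶ G.obj B, k = n A ≫ G.map (F.map k ≫ e B) := by
    intro k
    rw [G.map_comp, ← Category.assoc, ← hn, Category.assoc, t2, Category.comp_id]
  rw [key h, key h', H]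

theorem mixed (hn : ∀ {A B : D} (f : A ⟶ B), f ≫ n B = n A ≫ G.map (F.map f))
    (he : ∀ {A B : D} (f : A ⟶ B), F.map (G.map f) ≫ e B = e A ≫ f)
    (t1 : ∀ Z, F.map (n Z) ≫ e (F.obj Z) = 𝟙 _)
    (t2 : ∀ Z, n (G.obj Z) ≫ G.map (e Z) = 𝟙 _)
    (s a b : ∀ Z, F.obj (F.obj Z) ⟶ F.obj (F.obj Z))
    (hs : ∀ {A B : D} (g : A ⟶ B), F.map (F.map g) ≫ s B = s A ≫ F.map (F.map g))
    (ha : ∀ {A B : D} (g : A ⟶ B), F.map (F.map g) ≫ a B = a A ≫ F.map (F.map g))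
    (hb : ∀ {A B : D} (g : A ⟶ B), F.map (F.map g) ≫ b B = b A ≫ F.map (F.map g))
    (Y : ∀ W, F.map (s W) ≫ b (F.obj W) ≫ F.map (a W) = a (F.obj W) ≫ F.map (b W) ≫ s (F.obj W))
    (Z : D) :
    s (G.obj Z) ≫ F.map (L F G F F n e a Z) ≫ L F G F F n e b (F.obj Z) =
      F.map (L F G F F n e b Z) ≫ L F G F F n e a (F.obj Z) ≫ G.map (s Z) := by
  apply F_inj hn t2
  have ea := L_eq1 (U := F) (V := F) he t1 a
  have eb := L_eq1 (U := F) (V := F) he t1 b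
  simp only [F.map_comp, Category.assoc]
  rw [eb, he, reassoc_of% hb, ← F.map_comp, ea, reassoc_of% ea, reassoc_of% ha,
    ← F.map_comp_assoc, eb, F.map_comp, F.map_comp, reassoc_of% (Y (G.obj Z)), Category.assoc, hs]

theorem core (hn : ∀ {A B : D} (f : A ⟶ B), f ≫ n B = n A ≫ G.map (F.map f))
    (he : ∀ {A B : D} (f : A ⟶ B), F.map (G.map f) ≫ e B = e A ≫ f)
    (t1 : ∀ Z, F.map (n Z) ≫ e (F.obj Z) = 𝟙 _)
    (t2 : ∀ Z, n (G.obj Z) ≫ G.map (e Z) = 𝟙 _)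
    (r rinv : ∀ Z, F.obj (F.obj Z) ⟶ F.obj (F.obj Z))
    (hr : ∀ {A B : D} (g : A ⟶ B), F.map (F.map g) ≫ r B = r A ≫ F.map (F.map g))
    (hrinv : ∀ {A B : D} (g : A ⟶ B), F.map (F.map g) ≫ rinv B = rinv A ≫ F.map (F.map g))
    (rrinv : ∀ Z, r Z ≫ rinv Z = 𝟙 _) (rinvr : ∀ Z, rinv Z ≫ r Z = 𝟙 _)
    (ybe : ∀ Z, r (F.obj Z) ≫ F.map (r Z) ≫ r (F.obj Z) = F.map (r Z) ≫ r (F.obj Z) ≫ F.map (r Z))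
    (P M : ∀ Z, F.obj (G.obj Z) ⟶ G.obj (F.obj Z))
    (hP : P = L F G F F n e r) (hM : M = L F G F F n e rinv)
    (Pinv Minv : ∀ Z, G.obj (F.obj Z) ⟶ F.obj (G.obj Z))
    (PPinv : ∀ Z, P Z ≫ Pinv Z = 𝟙 _) (PinvP : ∀ Z, Pinv Z ≫ P Z = 𝟙 _)
    (MMinv : ∀ Z, M Z ≫ Minv Z = 𝟙 _) (MinvM : ∀ Z, Minv Z ≫ M Z = 𝟙 _) (Z : D) :
    (G.map (n Z ≫ Minv Z) ≫ Pinv (G.obj Z) ≫ e (G.obj Z) = 𝟙 _) ∧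
    ((n (F.obj Z) ≫ Minv (F.obj Z)) ≫ F.map (Pinv Z ≫ e Z) = 𝟙 _) := by
  have Frrinv : ∀ Z, F.map (r Z) ≫ F.map (rinv Z) = 𝟙 _ := fun Z => by
    rw [← F.map_comp, rrinv, F.map_id]
  have Frinvr : ∀ Z, F.map (rinv Z) ≫ F.map (r Z) = 𝟙 _ := fun Z => by
    rw [← F.map_comp, rinvr, F.map_id]
  have FPPinv : ∀ Z, F.map (P Z) ≫ F.map (Pinv Z) = 𝟙 _ := fun Z => by
    rw [← F.map_comp, PPinv, F.map_id]
  have FMMinv : ∀ Z, F.map (M Z) ≫ F.map (Minv Z) = 𝟙 _ := fun Z => by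
    rw [← F.map_comp, MMinv, F.map_id]
  have GPPinv : ∀ Z, G.map (P Z) ≫ G.map (Pinv Z) = 𝟙 _ := fun Z => by
    rw [← G.map_comp, PPinv, G.map_id]
  have GMinvM : ∀ Z, G.map (Minv Z) ≫ G.map (M Z) = 𝟙 _ := fun Z => by
    rw [← G.map_comp, MinvM, G.map_id]
  have FMinvM : ∀ Z, F.map (Minv Z) ≫ F.map (M Z) = 𝟙 _ := fun Z => by
    rw [← F.map_comp, MinvM, F.map_id]
  have Grrinv : ∀ Z, G.map (r Z) ≫ G.map (rinv Z) = 𝟙 _ := fun Z => by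
    rw [← G.map_comp, rrinv, G.map_id]
  have Y1 : ∀ W, F.map (rinv W) ≫ rinv (F.obj W) ≫ F.map (r W) =
      r (F.obj W) ≫ F.map (rinv W) ≫ rinv (F.obj W) := by
    intro W
    have h : r (F.obj W) ≫ F.map (r W) ≫ (F.map (rinv W) ≫ rinv (F.obj W) ≫ F.map (r W)) ≫
          r (F.obj W) ≫ F.map (r W) =
        r (F.obj W) ≫ F.map (r W) ≫ (r (F.obj W) ≫ F.map (rinv W) ≫ rinv (F.obj W)) ≫
          r (F.obj W) ≫ F.map (r W) := by
      simp only [Category.assoc, reassoc_of% Frrinv, reassoc_of% rrinv, reassoc_of% rinvr, Frinvr,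
        Category.comp_id]
      rw [ybe]
    have e1 : ∀ x : F.obj (F.obj (F.obj W)) ⟶ F.obj (F.obj (F.obj W)),
        x = F.map (rinv W) ≫ ((rinv (F.obj W) ≫ (r (F.obj W) ≫ F.map (r W) ≫ x ≫
          r (F.obj W) ≫ F.map (r W))) ≫ F.map (rinv W)) ≫ rinv (F.obj W) := by
      intro x
      simp only [Category.assoc, reassoc_of% Frrinv, rrinv, reassoc_of% rinvr, reassoc_of% Frinvr,
        Category.comp_id]
    rw [e1 (F.map (rinv W) ≫ rinv (F.obj W) ≫ F.map (r W)), h, ← e1]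
  have Y2 : ∀ W, F.map (rinv W) ≫ r (F.obj W) ≫ F.map (r W) =
      r (F.obj W) ≫ F.map (r W) ≫ rinv (F.obj W) := by
    intro W
    have h := congrArg (fun x => F.map (rinv W) ≫ x ≫ rinv (F.obj W)) (ybe W)
    simp only [Category.assoc, reassoc_of% Frinvr, rrinv, Category.comp_id] at h
    exact h
  have A := mixed hn he t1 t2 rinv r rinv hrinv hr hrinv Y1 Z
  have B := mixed hn he t1 t2 rinv r r hrinv hr hr Y2
  rw [← hP] at B
  rw [← hP, ← hM] at A
  have P1 := L_eq1 (U := F) (V := F) he t1 r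
  have M1 := L_eq1 (U := F) (V := F) he t1 rinv
  have P2 := L_eq2 (U := F) (V := F) hn t1 r hr
  have nP : ∀ {A B : D} (g : A ⟶ B), F.map (G.map g) ≫ P B = P A ≫ G.map (F.map g) := by
    subst hP
    intro A B g
    exact L_nat (U := F) (V := F) hn he r hr g
  have nM : ∀ {A B : D} (g : A ⟶ B), F.map (G.map g) ≫ M B = M A ≫ G.map (F.map g) := by
    subst hM
    intro A B g
    exact L_nat (U := F) (V := F) hn he rinv hrinv g
  rw [← hP] at P1 P2
  rw [← hM] at M1
  constructor
  ·
    have R1 := L_eq1 (U := G) (V := G) he t1 P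
    have S1 := L_eq1 (U := G) (V := G) he t1 M
    have R2 := L_eq2 (U := G) (V := G) hn t1 P nP
    have nR : ∀ {A B : D} (g : A ⟶ B), G.map (G.map g) ≫ L F G G G n e P B =
        L F G G G n e P A ≫ G.map (G.map g) := fun g => L_nat (U := G) (V := G) hn he P nP g
    generalize L F G G G n e P = R at *
    generalize L F G G G n e M = S at *
    have RS : ∀ Z, R Z ≫ S Z = 𝟙 _ := by
      intro Z
      apply F_inj hn t2
      apply F_inj hn t2
      simp only [F.map_comp, Category.assoc, F.map_id, Category.id_comp]
      have hS : F.map (F.map (S Z)) ≫ F.map (e (G.obj Z)) ≫ e Z =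
          rinv (G.obj (G.obj Z)) ≫ F.map (e (G.obj Z)) ≫ e Z := by
        rw [← F.map_comp_assoc, S1, F.map_comp_assoc, he, reassoc_of% M1]
      have hR : F.map (F.map (R Z)) ≫ F.map (e (G.obj Z)) ≫ e Z =
          r (G.obj (G.obj Z)) ≫ F.map (e (G.obj Z)) ≫ e Z := by
        rw [← F.map_comp_assoc, R1, F.map_comp_assoc, he, reassoc_of% P1]
      rw [hS, reassoc_of% hrinv, hR, reassoc_of% rinvr]
    have Bb : P (G.obj Z) ≫ G.map (M Z) ≫ R (F.obj Z) = F.map (R Z) ≫ M (G.obj Z) ≫ G.map (P Z) := by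
      apply F_inj hn t2
      simp only [F.map_comp, Category.assoc]
      rw [R1, reassoc_of% nP, ← G.map_comp, M1, G.map_comp, he, reassoc_of% M1, reassoc_of% hrinv,
        ← F.map_comp_assoc, R1, F.map_comp_assoc, nP, reassoc_of% (B (G.obj Z))]
    have FRS : F.map (R Z) ≫ F.map (S Z) = 𝟙 _ := by
      rw [← F.map_comp, RS, F.map_id]
    have h : G.map (Minv Z) ≫ Pinv (G.obj Z) =
        R (F.obj Z) ≫ G.map (Pinv Z) ≫ Minv (G.obj Z) ≫ F.map (S Z) := by
      have h2 := congrArg (fun x => G.map (Minv Z) ≫ Pinv (G.obj Z) ≫ x ≫ G.map (Pinv Z) ≫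
        Minv (G.obj Z) ≫ F.map (S Z)) Bb
      simp only [Category.assoc, reassoc_of% PinvP, reassoc_of% GMinvM, reassoc_of% GPPinv,
        reassoc_of% MMinv, FRS, Category.comp_id] at h2
      exact h2.symm
    rw [G.map_comp, Category.assoc, reassoc_of% h, S1, reassoc_of% MinvM, reassoc_of% R2,
      reassoc_of% GPPinv, t2]
  · have h : Minv (F.obj Z) ≫ F.map (Pinv Z) =
        G.map (r Z) ≫ Pinv (F.obj Z) ≫ F.map (Minv Z) ≫ rinv (G.obj Z) := by
      have h2 := congrArg (fun x => G.map (r Z) ≫ Pinv (F.obj Z) ≫ F.map (Minv Z) ≫ x ≫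
        Minv (F.obj Z) ≫ F.map (Pinv Z)) A
      simp only [Category.assoc, reassoc_of% FMinvM, reassoc_of% PinvP, reassoc_of% Grrinv,
        reassoc_of% MMinv, FPPinv, Category.comp_id] at h2
      exact h2.symm
    rw [F.map_comp, Category.assoc, reassoc_of% h, ← M1, reassoc_of% FMinvM, ← reassoc_of% P2,
      reassoc_of% PPinv, t1]

end Core

theorem lp_hat {X Y U V : C} (η : 𝟙_ C ⟶ Y ⊗ X) (ε : X ⊗ Y ⟶ 𝟙_ C)
    (f : X ⊗ U ⟶ V ⊗ X) (Z : C) :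
    (α_ U Y Z).inv ≫ lp η ε f ▷ Z ≫ (α_ Y V Z).hom =
    L (tensorLeft X) (tensorLeft Y) (tensorLeft U) (tensorLeft V)
      (fun Z => (λ_ Z).inv ≫ η ▷ Z ≫ (α_ Y X Z).hom)
      (fun Z => (α_ X Y Z).inv ≫ ε ▷ Z ≫ (λ_ Z).hom)
      (fun Z => (α_ X U Z).inv ≫ f ▷ Z ≫ (α_ V X Z).hom) Z := by
  unfold lp L
  dsimp
  monoidal

/-- if `(C, X, ρ)` is an R-matrix such that `ρ` and `ρ⁻¹` are `X`-left
isomorphisms w.r.t. a duality `p = ⟨X, Y, η, ε⟩`, then with `ρ± = l_p(ρ^{±1})` the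
morphisms `η̄ = ρ₋⁻¹ ∘ η` and `ε̄ = ε ∘ ρ₊⁻¹` satisfy the zig-zag identities, so
`⟨Y, X, η̄, ε̄⟩` is a duality and `X` is strongly rigid. -/
theorem statement4 {X Y : C} (ρ : X ⊗ X ⟶ X ⊗ X) [IsIso ρ]
    (ybe : ρ ▷ X ≫ ((α_ X X X).hom ≫ X ◁ ρ ≫ (α_ X X X).inv) ≫ ρ ▷ X =
      ((α_ X X X).hom ≫ X ◁ ρ ≫ (α_ X X X).inv) ≫ ρ ▷ X ≫
        ((α_ X X X).hom ≫ X ◁ ρ ≫ (α_ X X X).inv))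
    (η : 𝟙_ C ⟶ Y ⊗ X) (ε : X ⊗ Y ⟶ 𝟙_ C)
    (zig : (ρ_ X).inv ≫ X ◁ η ≫ (α_ X Y X).inv ≫ ε ▷ X ≫ (λ_ X).hom = 𝟙 X)
    (zag : (λ_ Y).inv ≫ η ▷ Y ≫ (α_ Y X Y).hom ≫ Y ◁ ε ≫ (ρ_ Y).hom = 𝟙 Y)
    (hplus : IsIso (lp η ε ρ)) (hminus : IsIso (lp η ε (inv ρ))) :
    ∀ ηbar : 𝟙_ C ⟶ X ⊗ Y, ∀ εbar : Y ⊗ X ⟶ 𝟙_ C,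
    ηbar = η ≫ inv (lp η ε (inv ρ)) →
    εbar = inv (lp η ε ρ) ≫ ε →
    ((ρ_ Y).inv ≫ Y ◁ ηbar ≫ (α_ Y X Y).inv ≫ εbar ▷ Y ≫ (λ_ Y).hom = 𝟙 Y) ∧
    ((λ_ X).inv ≫ ηbar ▷ X ≫ (α_ X Y X).hom ≫ X ◁ εbar ≫ (ρ_ X).hom = 𝟙 X) := by
  rintro _ _ rfl rfl
  have hPdef : (fun Z => (α_ X Y Z).inv ≫ lp η ε ρ ▷ Z ≫ (α_ Y X Z).hom) =
      L (tensorLeft X) (tensorLeft Y) (tensorLeft X) (tensorLeft X)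
      (fun Z => (λ_ Z).inv ≫ η ▷ Z ≫ (α_ Y X Z).hom)
      (fun Z => (α_ X Y Z).inv ≫ ε ▷ Z ≫ (λ_ Z).hom)
      (fun Z => (α_ X X Z).inv ≫ ρ ▷ Z ≫ (α_ X X Z).hom) := by
    funext Z
    exact lp_hat η ε ρ Z
  have hMdef : (fun Z => (α_ X Y Z).inv ≫ lp η ε (inv ρ) ▷ Z ≫ (α_ Y X Z).hom) =
      L (tensorLeft X) (tensorLeft Y) (tensorLeft X) (tensorLeft X)
      (fun Z => (λ_ Z).inv ≫ η ▷ Z ≫ (α_ Y X Z).hom)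
      (fun Z => (α_ X Y Z).inv ≫ ε ▷ Z ≫ (λ_ Z).hom)
      (fun Z => (α_ X X Z).inv ≫ inv ρ ▷ Z ≫ (α_ X X Z).hom) := by
    funext Z
    exact lp_hat η ε (inv ρ) Z
  have main := core (F := tensorLeft X) (G := tensorLeft Y)
    (n := fun Z => (λ_ Z).inv ≫ η ▷ Z ≫ (α_ Y X Z).hom)
    (e := fun Z => (α_ X Y Z).inv ≫ ε ▷ Z ≫ (λ_ Z).hom)
    (by
      intro A B f
      dsimp
      rw [leftUnitor_inv_naturality_assoc, whisker_exchange_assoc]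
      simp only [Category.assoc, associator_naturality_right])
    (by
      intro A B f
      dsimp
      rw [associator_inv_naturality_right_assoc, whisker_exchange_assoc]
      simp only [Category.assoc, associator_naturality_right, leftUnitor_naturality])
    (by
      intro Z
      have h := congrArg (fun k => k ▷ Z) zig
      dsimp at h ⊢
      rw [id_whiskerRight] at h
      rw [← h]
      monoidal)
    (by
      intro Z
      have h := congrArg (fun k => k ▷ Z) zag
      dsimp at h ⊢
      rw [id_whiskerRight] at h
      rw [← h]
      monoidal)
    (fun Z => (α_ X X Z).inv ≫ ρ ▷ Z ≫ (α_ X X Z).hom)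
    (fun Z => (α_ X X Z).inv ≫ inv ρ ▷ Z ≫ (α_ X X Z).hom)
    (by
      intro A B f
      dsimp
      rw [associator_inv_naturality_right_assoc, whisker_exchange_assoc]
      simp only [Category.assoc, associator_naturality_right, leftUnitor_naturality])
    (by
      intro A B f
      dsimp
      rw [associator_inv_naturality_right_assoc, whisker_exchange_assoc]
      simp only [Category.assoc, associator_naturality_right, leftUnitor_naturality])
    (by intro Z; dsimp; simp)
    (by intro Z; dsimp; simp)
    (by
      intro Z
      have h := congrArg (fun k => (α_ X X (X ⊗ Z)).inv ≫ (α_ (X ⊗ X) X Z).inv ≫ k ▷ Z ≫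
        (α_ (X ⊗ X) X Z).hom ≫ (α_ X X (X ⊗ Z)).hom) ybe
      dsimp at h ⊢
      convert h using 1 <;> monoidal)
    (fun Z => (α_ X Y Z).inv ≫ lp η ε ρ ▷ Z ≫ (α_ Y X Z).hom)
    (fun Z => (α_ X Y Z).inv ≫ lp η ε (inv ρ) ▷ Z ≫ (α_ Y X Z).hom)
    hPdef hMdef
    (fun Z => (α_ Y X Z).inv ≫ inv (lp η ε ρ) ▷ Z ≫ (α_ X Y Z).hom)
    (fun Z => (α_ Y X Z).inv ≫ inv (lp η ε (inv ρ)) ▷ Z ≫ (α_ X Y Z).hom)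
    (by intro Z; dsimp; simp)
    (by intro Z; dsimp; simp)
    (by intro Z; dsimp; simp)
    (by intro Z; dsimp; simp)
    (𝟙_ C)
  obtain ⟨m1, m2⟩ := main
  dsimp at m1 m2
  generalize inv (lp η ε ρ) = p at *
  generalize inv (lp η ε (inv ρ)) = m at *
  constructor
  · have h := congrArg (fun k => (ρ_ Y).inv ≫ k ≫ (ρ_ Y).hom) m1
    rw [Category.id_comp, Iso.inv_hom_id] at h
    rw [← h]
    monoidal
  · have h := congrArg (fun k => (ρ_ X).inv ≫ k ≫ (ρ_ X).hom) m2
    rw [Category.id_comp, Iso.inv_hom_id] at h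
    rw [← h]
    monoidal

end Stmt4
end

section
/- Let H be a finite-dimensional Hopf algebra over a field K with invertible antipode, X its underlying space, and let τ = σ ∘ (id ⊗ ∇) ∘ (Δ ⊗ id) be the associated T-matrix with r_p the partial transpose with respect to the canonical duality p = ⟨X*, X, coev, eval⟩. Then the map ρ_τ : (X ⊗ X*)⊗² → (X ⊗ X*)⊗² defined by ρ_τ = (id_X ⊗ (r_p(τ))⁻¹ ⊗ id_{X*}) ∘ (τ ⊗ r_p(r_p(τ))) ∘ (id_X ⊗ r_p(τ⁻¹) ⊗ id_{X*}) is an invertible solution of the Yang–Baxter equation on X ⊗ X*, with inverse ρ_{τ⁻¹} (the same formula with τ replaced by τ⁻¹). -/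
open TensorProduct

namespace Stmt18

variable {K H : Type*} [Field K] [Ring H] [HopfAlgebra K H] [FiniteDimensional K H]

/-- The partial transpose `r_p` (in the first tensor factor) of a linear map
`f : U ⊗ X → X ⊗ V`, w.r.t. the canonical duality `p = ⟨X*, X, coev, eval⟩`. -/
noncomputable def rp {X U V : Type*} [AddCommGroup X] [Module K X]
    [FiniteDimensional K X] [AddCommGroup U] [Module K U] [AddCommGroup V] [Module K V]
    (f : U ⊗[K] X →ₗ[K] X ⊗[K] V) :
    Module.Dual K X ⊗[K] U →ₗ[K] V ⊗[K] Module.Dual K X :=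
  LinearMap.rTensor (Module.Dual K X)
      ((TensorProduct.lid K V).toLinearMap ∘ₗ
        LinearMap.rTensor V (contractLeft K X) ∘ₗ
          (TensorProduct.assoc K (Module.Dual K X) X V).symm.toLinearMap ∘ₗ
            LinearMap.lTensor (Module.Dual K X) f ∘ₗ
              (TensorProduct.assoc K (Module.Dual K X) U X).toLinearMap) ∘ₗ
    (TensorProduct.assoc K (Module.Dual K X ⊗[K] U) X (Module.Dual K X)).symm.toLinearMap ∘ₗ
      LinearMap.lTensor (Module.Dual K X ⊗[K] U) (coevaluation K X) ∘ₗ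
        (TensorProduct.rid K (Module.Dual K X ⊗[K] U)).symm.toLinearMap

/-- `τ = σ ∘ (id ⊗ ∇) ∘ (Δ ⊗ id)`, i.e. `τ(x ⊗ y) = Σ x₍₂₎ y ⊗ x₍₁₎`. -/
noncomputable def τ : H ⊗[K] H →ₗ[K] H ⊗[K] H :=
  (TensorProduct.comm K H H).toLinearMap ∘ₗ
    LinearMap.lTensor H (LinearMap.mul' K H) ∘ₗ
      (TensorProduct.assoc K H H H).toLinearMap ∘ₗ
        LinearMap.rTensor H (Coalgebra.comul (R := K) (A := H))

/-- Apply `g : X* ⊗ X → X ⊗ X*` to the middle two factors of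
`(X ⊗ X*) ⊗ (X ⊗ X*)`, landing in `(X ⊗ X) ⊗ (X* ⊗ X*)`. -/
noncomputable def inn (g : Module.Dual K H ⊗[K] H →ₗ[K] H ⊗[K] Module.Dual K H) :
    (H ⊗[K] Module.Dual K H) ⊗[K] (H ⊗[K] Module.Dual K H) →ₗ[K]
      (H ⊗[K] H) ⊗[K] (Module.Dual K H ⊗[K] Module.Dual K H) :=
  (TensorProduct.assoc K H H (Module.Dual K H ⊗[K] Module.Dual K H)).symm.toLinearMap ∘ₗ
    LinearMap.lTensor H
        ((TensorProduct.assoc K H (Module.Dual K H) (Module.Dual K H)).toLinearMap ∘ₗ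
          LinearMap.rTensor (Module.Dual K H) g ∘ₗ
            (TensorProduct.assoc K (Module.Dual K H) H
                (Module.Dual K H)).symm.toLinearMap) ∘ₗ
      (TensorProduct.assoc K H (Module.Dual K H)
          (H ⊗[K] Module.Dual K H)).toLinearMap

/-- Apply `g' : X ⊗ X* → X* ⊗ X` to the middle two factors of
`(X ⊗ X) ⊗ (X* ⊗ X*)`, landing back in `(X ⊗ X*) ⊗ (X ⊗ X*)`. -/
noncomputable def inn' (g' : H ⊗[K] Module.Dual K H →ₗ[K] Module.Dual K H ⊗[K] H) :
    (H ⊗[K] H) ⊗[K] (Module.Dual K H ⊗[K] Module.Dual K H) →ₗ[K]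
      (H ⊗[K] Module.Dual K H) ⊗[K] (H ⊗[K] Module.Dual K H) :=
  (TensorProduct.assoc K H (Module.Dual K H)
      (H ⊗[K] Module.Dual K H)).symm.toLinearMap ∘ₗ
    LinearMap.lTensor H
        ((TensorProduct.assoc K (Module.Dual K H) H (Module.Dual K H)).toLinearMap ∘ₗ
          LinearMap.rTensor (Module.Dual K H) g' ∘ₗ
            (TensorProduct.assoc K H (Module.Dual K H)
                (Module.Dual K H)).symm.toLinearMap) ∘ₗ
      (TensorProduct.assoc K H H
          (Module.Dual K H ⊗[K] Module.Dual K H)).toLinearMap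

/-- `ρ_g = (id_X ⊗ g_out ⊗ id_{X*}) ∘ (t ⊗ t') ∘ (id_X ⊗ g_in ⊗ id_{X*})` on
`(X ⊗ X*)⊗²`; for `g_out = (r_p(τ))⁻¹`, `t = τ`, `t' = r_p(r_p(τ))`, `g_in = r_p(τ⁻¹)`
this is `ρ_τ`. -/
noncomputable def rho (t : H ⊗[K] H →ₗ[K] H ⊗[K] H)
    (t' : Module.Dual K H ⊗[K] Module.Dual K H →ₗ[K]
      Module.Dual K H ⊗[K] Module.Dual K H)
    (gin : Module.Dual K H ⊗[K] H →ₗ[K] H ⊗[K] Module.Dual K H)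
    (gout : H ⊗[K] Module.Dual K H →ₗ[K] Module.Dual K H ⊗[K] H) :
    (H ⊗[K] Module.Dual K H) ⊗[K] (H ⊗[K] Module.Dual K H) →ₗ[K]
      (H ⊗[K] Module.Dual K H) ⊗[K] (H ⊗[K] Module.Dual K H) :=
  inn' (K := K) gout ∘ₗ TensorProduct.map t t' ∘ₗ inn (K := K) gin

/-- `f ⊗ id_W` on `(W ⊗ W) ⊗ W` for `W = X ⊗ X*`. -/
noncomputable def W1
    (f : (H ⊗[K] Module.Dual K H) ⊗[K] (H ⊗[K] Module.Dual K H) →ₗ[K]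
      (H ⊗[K] Module.Dual K H) ⊗[K] (H ⊗[K] Module.Dual K H)) :=
  LinearMap.rTensor (H ⊗[K] Module.Dual K H) f

/-- `id_W ⊗ f` on `(W ⊗ W) ⊗ W` for `W = X ⊗ X*`. -/
noncomputable def W2
    (f : (H ⊗[K] Module.Dual K H) ⊗[K] (H ⊗[K] Module.Dual K H) →ₗ[K]
      (H ⊗[K] Module.Dual K H) ⊗[K] (H ⊗[K] Module.Dual K H)) :=
  (TensorProduct.assoc K (H ⊗[K] Module.Dual K H) (H ⊗[K] Module.Dual K H)
      (H ⊗[K] Module.Dual K H)).symm.toLinearMap ∘ₗ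
    LinearMap.lTensor (H ⊗[K] Module.Dual K H) f ∘ₗ
      (TensorProduct.assoc K (H ⊗[K] Module.Dual K H) (H ⊗[K] Module.Dual K H)
          (H ⊗[K] Module.Dual K H)).toLinearMap


section Helpers

/-- contraction of the last tensor factor with a vector -/
noncomputable def ev {X : Type*} (M : Type*) [AddCommGroup X] [Module K X] [AddCommGroup M]
    [Module K M] (a : X) : M ⊗[K] Module.Dual K X →ₗ[K] M :=
  (TensorProduct.rid K M).toLinearMap ∘ₗ LinearMap.lTensor M (Module.Dual.eval K X a)

/-- separating families of linear maps -/
def Sep {ι P Q : Type*} [AddCommGroup P] [Module K P] [AddCommGroup Q] [Module K Q]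
    (T : ι → (P →ₗ[K] Q)) : Prop :=
  ∃ (s : Finset ι) (R : ι → (Q →ₗ[K] P)), ∀ t, ∑ i ∈ s, R i (T i t) = t

section
variable {X M N P Q U V ι : Type*} [AddCommGroup X] [Module K X] [AddCommGroup M] [Module K M]
  [AddCommGroup N] [Module K N] [AddCommGroup P] [Module K P] [AddCommGroup Q] [Module K Q]
  [AddCommGroup U] [Module K U] [AddCommGroup V] [Module K V]

@[simp] lemma ev_tmul (a : X) (m : M) (f : Module.Dual K X) :
    ev M a (m ⊗ₜ[K] f) = f a • m := by
  simp [ev]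

lemma ev_rTensor (a : X) (φ : M →ₗ[K] N) (t : M ⊗[K] Module.Dual K X) :
    ev N a (LinearMap.rTensor _ φ t) = φ (ev M a t) := by
  induction t with
  | zero => simp
  | tmul x y => simp
  | add x y hx hy => simp [hx, hy]

lemma Sep.ext' {T : ι → (P →ₗ[K] Q)} (h : Sep T) {t t' : P} (H : ∀ i, T i t = T i t') :
    t = t' := by
  obtain ⟨s, R, h⟩ := h
  rw [← h t, ← h t']
  simp [H]

lemma Sep.lTensor (N : Type*) [AddCommGroup N] [Module K N] {T : ι → (P →ₗ[K] Q)} (h : Sep T) :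
    Sep (fun i => LinearMap.lTensor N (T i)) := by
  obtain ⟨s, R, h⟩ := h
  refine ⟨s, fun i => LinearMap.lTensor N (R i), fun t => ?_⟩
  induction t with
  | zero => simp
  | tmul x y => simp [← TensorProduct.tmul_sum, h]
  | add x y hx hy => simp [Finset.sum_add_distrib, hx, hy]

lemma sep_ev [FiniteDimensional K X] :
    Sep (fun a : X => ev (K := K) M a) := by
  classical
  let b := Module.finBasis K X
  refine ⟨Finset.univ.image b, fun i => if h : ∃ k, b k = i then
    (TensorProduct.mk K M (Module.Dual K X)).flip (b.coord h.choose) else 0, fun t => ?_⟩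
  rw [Finset.sum_image (by intro i _ j _ h; exact b.injective h)]
  have key : ∀ k, (if h : ∃ k', b k' = b k then
    (TensorProduct.mk K M (Module.Dual K X)).flip (b.coord h.choose) else 0) =
    (TensorProduct.mk K M (Module.Dual K X)).flip (b.coord k) := by
    intro k
    have h : ∃ k', b k' = b k := ⟨k, rfl⟩
    rw [dif_pos h, b.injective h.choose_spec]
  simp only [key]
  induction t with
  | zero => simp
  | tmul x f =>
    simp only [ev_tmul, LinearMap.flip_apply, TensorProduct.mk_apply, TensorProduct.smul_tmul]
    rw [← TensorProduct.tmul_sum]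
    congr 1
    apply b.ext
    intro j
    simp
  | add x y hx hy => simp only [map_add, Finset.sum_add_distrib, hx, hy]

/-- a linear map as an element of the tensor product -/
noncomputable def curl [FiniteDimensional K X] (φ : X →ₗ[K] M) : M ⊗[K] Module.Dual K X :=
  LinearMap.rTensor _ φ (coevaluation K X 1)

lemma ev_curl [FiniteDimensional K X] (φ : X →ₗ[K] M) (a : X) : ev M a (curl φ) = φ a := by
  rw [curl, ev_rTensor]
  congr 1
  rw [coevaluation_apply_one]
  simp only [map_sum, ev_tmul]
  exact (Module.Basis.ofVectorSpace K X).sum_repr a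

lemma ev_rp [FiniteDimensional K X] (f : U ⊗[K] X →ₗ[K] X ⊗[K] V) (φ : Module.Dual K X) (u : U)
    (a : X) : ev V a (rp f (φ ⊗ₜ u)) =
      TensorProduct.lid K V (LinearMap.rTensor V φ (f (u ⊗ₜ a))) := by
  have h1 : ∀ t : X ⊗[K] Module.Dual K X,
      ev V a (LinearMap.rTensor (Module.Dual K X)
      ((TensorProduct.lid K V).toLinearMap ∘ₗ
        LinearMap.rTensor V (contractLeft K X) ∘ₗ
          (TensorProduct.assoc K (Module.Dual K X) X V).symm.toLinearMap ∘ₗ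
            LinearMap.lTensor (Module.Dual K X) f ∘ₗ
              (TensorProduct.assoc K (Module.Dual K X) U X).toLinearMap)
        ((TensorProduct.assoc K (Module.Dual K X ⊗[K] U) X (Module.Dual K X)).symm
          ((φ ⊗ₜ u) ⊗ₜ t))) =
      TensorProduct.lid K V (LinearMap.rTensor V φ (f (u ⊗ₜ ev X a t))) := by
    intro t
    induction t with
    | zero => simp
    | tmul x y =>
      simp only [TensorProduct.assoc_symm_tmul, ev_tmul, map_smul,
        TensorProduct.tmul_smul, LinearMap.rTensor_tmul, LinearMap.comp_apply,
        LinearEquiv.coe_coe, TensorProduct.assoc_tmul, LinearMap.lTensor_tmul]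
      congr 2
      generalize f (u ⊗ₜ x) = s
      induction s with
      | zero => simp
      | tmul p q => simp [contractLeft_apply]
      | add p q hp hq => simp only [TensorProduct.tmul_add, map_add, hp, hq]
    | add x y hx hy => simp only [TensorProduct.tmul_add, map_add, hx, hy]
  have := h1 (coevaluation K X 1)
  rw [show ev X a (coevaluation K X 1) = a by
    have := ev_curl (K := K) (LinearMap.id : X →ₗ[K] X) a
    simpa [curl] using this] at this
  rw [← this]
  simp [rp]

end


set_option linter.unusedSectionVars false

section YD
variable {W : Type*} [AddCommGroup W] [Module K W]

/-- braiding from an action and a coaction -/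
noncomputable def ydb (A : H →ₗ[K] W →ₗ[K] W) (δ : W →ₗ[K] H ⊗[K] W) :
    W ⊗[K] W →ₗ[K] W ⊗[K] W :=
  TensorProduct.lift ((LinearMap.rTensorHom W ∘ₗ A.flip).flip ∘ₗ δ)

lemma ydb_tmul (A : H →ₗ[K] W →ₗ[K] W) (δ : W →ₗ[K] H ⊗[K] W) (w w' : W) :
    ydb A δ (w ⊗ₜ w') = LinearMap.rTensor W (A.flip w') (δ w) := by
  simp [ydb]

/-- left side of the compatibility condition -/
noncomputable def Z1 (A : H →ₗ[K] W →ₗ[K] W) (δ : W →ₗ[K] H ⊗[K] W) (w : W) :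
    H ⊗[K] H →ₗ[K] H ⊗[K] W :=
  TensorProduct.lift (LinearMap.compl₂ (LinearMap.rTensorHom W ∘ₗ (LinearMap.mul K H).flip)
    (δ ∘ₗ A.flip w))

/-- right side of the compatibility condition -/
noncomputable def Z2' (A : H →ₗ[K] W →ₗ[K] W) : H ⊗[K] W →ₗ[K] H ⊗[K] H →ₗ[K] H ⊗[K] W :=
  (TensorProduct.lift ((TensorProduct.mapBilinear (RingHom.id K) H W H W).compl₁₂
    (LinearMap.mul K H) A).flip).flip

/-- right side of the compatibility condition -/
noncomputable def Z2 (A : H →ₗ[K] W →ₗ[K] W) (δ : W →ₗ[K] H ⊗[K] W) (w : W) :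
    H ⊗[K] H →ₗ[K] H ⊗[K] W := Z2' A (δ w)

lemma Z2'_tmul (A : H →ₗ[K] W →ₗ[K] W) (s : H ⊗[K] W) (h k : H) :
    Z2' A s (h ⊗ₜ k) = TensorProduct.map (LinearMap.mulLeft K k) (A h) s := by
  simp only [Z2', LinearMap.flip_apply, TensorProduct.lift.tmul]
  rfl

lemma Z1_tmul (A : H →ₗ[K] W →ₗ[K] W) (δ : W →ₗ[K] H ⊗[K] W) (w : W) (h k : H) :
    Z1 A δ w (h ⊗ₜ k) = LinearMap.rTensor W (LinearMap.mulRight K h) (δ (A k w)) := by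
  simp only [Z1, TensorProduct.lift.tmul]
  rfl

lemma Z2_tmul (A : H →ₗ[K] W →ₗ[K] W) (δ : W →ₗ[K] H ⊗[K] W) (w : W) (h k : H) :
    Z2 A δ w (h ⊗ₜ k) = TensorProduct.map (LinearMap.mulLeft K k) (A h) (δ w) := by
  rw [Z2, Z2'_tmul]

/-- the braiding on the last two factors -/
noncomputable def br2 (r : W ⊗[K] W →ₗ[K] W ⊗[K] W) :
    (W ⊗[K] W) ⊗[K] W →ₗ[K] (W ⊗[K] W) ⊗[K] W :=
  (TensorProduct.assoc K W W W).symm.toLinearMap ∘ₗ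
    LinearMap.lTensor W r ∘ₗ (TensorProduct.assoc K W W W).toLinearMap

lemma br2_tmul (r : W ⊗[K] W →ₗ[K] W ⊗[K] W) (a b c : W) :
    br2 r ((a ⊗ₜ b) ⊗ₜ c) = (TensorProduct.assoc K W W W).symm (a ⊗ₜ r (b ⊗ₜ c)) := by
  simp [br2]

lemma ybe_of_yd (A : H →ₗ[K] W →ₗ[K] W) (δ : W →ₗ[K] H ⊗[K] W)
    (hA : ∀ h k w, A (h * k) w = A h (A k w))
    (hδ : ∀ w, LinearMap.lTensor H δ (δ w) = TensorProduct.assoc K H H W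
      (LinearMap.rTensor W ((TensorProduct.comm K H H).toLinearMap ∘ₗ Coalgebra.comul) (δ w)))
    (hyd : ∀ h w, Z1 A δ w (Coalgebra.comul h) = Z2 A δ w (Coalgebra.comul h)) :
    LinearMap.rTensor W (ydb A δ) ∘ₗ br2 (ydb A δ) ∘ₗ LinearMap.rTensor W (ydb A δ) =
      br2 (ydb A δ) ∘ₗ LinearMap.rTensor W (ydb A δ) ∘ₗ br2 (ydb A δ) := by
  apply TensorProduct.ext_threefold
  intro w w' w''
  simp only [LinearMap.comp_apply, LinearMap.rTensor_tmul, ydb_tmul, br2_tmul]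
  -- left side
  let G1 : H ⊗[K] (H ⊗[K] W) →ₗ[K] (W ⊗[K] W) ⊗[K] W :=
    LinearMap.rTensor W (LinearMap.rTensor W (A.flip w'') ∘ₗ Z1 A δ w' ∘ₗ
      (TensorProduct.comm K H H).toLinearMap) ∘ₗ (TensorProduct.assoc K H H W).symm.toLinearMap
  let G2 : H ⊗[K] (H ⊗[K] W) →ₗ[K] (W ⊗[K] W) ⊗[K] W :=
    LinearMap.rTensor W (LinearMap.rTensor W (A.flip w'') ∘ₗ Z2 A δ w' ∘ₗ
      (TensorProduct.comm K H H).toLinearMap) ∘ₗ (TensorProduct.assoc K H H W).symm.toLinearMap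
  have hmul : ∀ k, A.flip (A k w'') = A.flip w'' ∘ₗ LinearMap.mulRight K k := by
    intro k; ext h; simp [hA]
  have L : ∀ t : H ⊗[K] W, LinearMap.rTensor W (ydb A δ) (br2 (ydb A δ)
      (LinearMap.rTensor W (A.flip w') t ⊗ₜ w'')) = G1 (LinearMap.lTensor H δ t) := by
    intro t
    induction t with
    | zero => simp
    | add x y hx hy => simp only [TensorProduct.add_tmul, map_add, hx, hy]
    | tmul h w0 =>
      simp only [LinearMap.rTensor_tmul, LinearMap.lTensor_tmul, br2_tmul, ydb_tmul]
      generalize δ w0 = s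
      induction s with
      | zero => simp
      | add x y hx hy => simp only [TensorProduct.tmul_add, map_add, hx, hy]
      | tmul k w1 =>
        simp [G1, Z1_tmul, ydb_tmul, hmul, LinearMap.rTensor_comp]
  have R : ∀ s : H ⊗[K] W, br2 (ydb A δ) (LinearMap.rTensor W (ydb A δ)
      ((TensorProduct.assoc K W W W).symm
      (w ⊗ₜ LinearMap.rTensor W (A.flip w'') s))) =
      LinearMap.rTensor W (LinearMap.rTensor W (A.flip w'') ∘ₗ Z2' A s ∘ₗ
      (TensorProduct.comm K H H).toLinearMap) ((TensorProduct.assoc K H H W).symm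
        (LinearMap.lTensor H δ (δ w))) := by
    intro s
    induction s with
    | zero => simp
    | add x y hx hy =>
      simp only [TensorProduct.tmul_add, map_add, hx, hy, LinearMap.add_comp, LinearMap.comp_add,
        LinearMap.rTensor_add, LinearMap.add_apply]
    | tmul k w0 =>
      simp only [LinearMap.rTensor_tmul, TensorProduct.assoc_symm_tmul, ydb_tmul]
      generalize δ w = t
      induction t with
      | zero => simp
      | add x y hx hy => simp only [TensorProduct.add_tmul, map_add, hx, hy]
      | tmul h w1 =>
        simp only [LinearMap.rTensor_tmul,
            LinearMap.lTensor_tmul, br2_tmul, ydb_tmul]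
        generalize δ w1 = s
        induction s with
        | zero => simp
        | add x y hx hy => simp only [TensorProduct.tmul_add, map_add, hx, hy]
        | tmul k w1 => simp [hA, Z2'_tmul]
  rw [L, R, hδ]
  change _ = G2 _
  generalize δ w = t
  induction t with
  | zero => simp
  | add x y hx hy => simp only [map_add, hx, hy]
  | tmul h w0 => simp [G1, G2, hyd]

end YD

section Hopf
open Coalgebra HopfAlgebra

local notation "Δ" => (comul : H →ₗ[K] H ⊗[K] H)
local notation "S" => (antipode K : H →ₗ[K] H)

/-- opposite comultiplication -/
noncomputable def Dop : H →ₗ[K] H ⊗[K] H := (TensorProduct.comm K H H).toLinearMap ∘ₗ comul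

lemma Dop_apply (x : H) : Dop (K := K) x = TensorProduct.comm K H H (Δ x) := rfl

lemma comm_mul (s t : H ⊗[K] H) : TensorProduct.comm K H H (s * t) =
    TensorProduct.comm K H H s * TensorProduct.comm K H H t := by
  induction s with
  | zero => simp
  | add x y hx hy => simp only [add_mul, map_add, hx, hy]
  | tmul a b =>
    induction t with
    | zero => simp
    | add x y hx hy => simp only [mul_add, map_add, hx, hy]
    | tmul c d => simp

lemma Dop_mul (x y : H) : Dop (K := K) (x * y) = Dop x * Dop y := by
  simp [Dop_apply, comm_mul]

lemma Dop_coassoc (x : H) : LinearMap.lTensor H (Dop (K := K)) (Dop (K := K) x) =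
    TensorProduct.assoc K H H H (LinearMap.rTensor H (Dop (K := K)) (Dop (K := K) x)) := by
  have h1 : ∀ t : H ⊗[K] H, LinearMap.lTensor H (Dop (K := K)) (TensorProduct.comm K H H t) =
    LinearMap.lTensor H (TensorProduct.comm K H H).toLinearMap
      (TensorProduct.comm K (H ⊗[K] H) H (LinearMap.rTensor H Δ t)) := by
    intro t
    induction t with
    | zero => simp
    | add x y hx hy => simp only [map_add, hx, hy]
    | tmul a b => simp [Dop_apply]
  have h2 : ∀ t : H ⊗[K] H, LinearMap.rTensor H (Dop (K := K)) (TensorProduct.comm K H H t) =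
    LinearMap.rTensor H (TensorProduct.comm K H H).toLinearMap
      (TensorProduct.comm K H (H ⊗[K] H) (LinearMap.lTensor H Δ t)) := by
    intro t
    induction t with
    | zero => simp
    | add x y hx hy => simp only [map_add, hx, hy]
    | tmul a b => simp [Dop_apply]
  rw [Dop_apply, h1, h2, ← Coalgebra.coassoc_apply]
  generalize LinearMap.rTensor H Δ (Δ x) = t
  induction t with
  | zero => simp
  | add x y hx hy => simp only [map_add, hx, hy]
  | tmul a b =>
    induction a with
    | zero => simp
    | add x y hx hy => simp only [TensorProduct.add_tmul, map_add, hx, hy]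
    | tmul c d => simp

lemma lam_comul (z : H) : LinearMap.rTensor H (LinearMap.mul' K H ∘ₗ LinearMap.rTensor H S)
    ((TensorProduct.assoc K H H H).symm (LinearMap.lTensor H Δ (Δ z))) = 1 ⊗ₜ z := by
  rw [Coalgebra.coassoc_symm_apply, ← LinearMap.comp_apply, ← LinearMap.rTensor_comp,
    LinearMap.comp_assoc, HopfAlgebra.mul_antipode_rTensor_comul, LinearMap.rTensor_comp,
    LinearMap.comp_apply, Coalgebra.rTensor_counit_comul]
  simp

lemma comul_antipode (x : H) : Δ (S x) = TensorProduct.map S S (Dop (K := K) x) := by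
  have h : (Δ ∘ₗ S) = TensorProduct.map S S ∘ₗ Dop (K := K) := by
    apply WithConv.toConv_injective
    symm
    apply left_inv_eq_right_inv (a := WithConv.toConv Δ) _ LinearMap.comul_right_inv
    apply WithConv.ext
    ext x
    simp only [LinearMap.convMul_def, LinearMap.convOne_def, WithConv.ofConv_toConv,
      LinearMap.comp_apply]
    -- Psi
    have h1 : ∀ t : H ⊗[K] H, LinearMap.mul' K (H ⊗[K] H)
        (TensorProduct.map (TensorProduct.map S S ∘ₗ Dop (K := K)) Δ t) =
        TensorProduct.lift (LinearMap.mk₂ K (fun (a : H) (r : H ⊗[K] H) =>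
          (1 ⊗ₜ[K] S a) * LinearMap.rTensor H (LinearMap.mul' K H ∘ₗ LinearMap.rTensor H S)
    ((TensorProduct.assoc K H H H).symm (LinearMap.lTensor H Δ r)))
          (by intros; simp [TensorProduct.tmul_add, add_mul]) (by intros; simp)
          (by intros; simp [mul_add]) (by intros; simp))
          (TensorProduct.assoc K H H H (LinearMap.rTensor H Δ t)) := by
      intro t
      induction t with
      | zero => simp
      | add x y hx hy => simp only [map_add, hx, hy]
      | tmul p q =>
        simp only [TensorProduct.map_tmul, LinearMap.comp_apply, Dop_apply,
          LinearMap.rTensor_tmul, LinearMap.mul'_apply]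
        generalize Δ p = s
        induction s with
        | zero => simp
        | add x y hx hy => simp only [map_add, add_mul, TensorProduct.add_tmul, hx, hy]
        | tmul a b =>
          simp only [TensorProduct.assoc_tmul, TensorProduct.lift.tmul, LinearMap.mk₂_apply,
            LinearMap.lTensor_tmul]
          generalize Δ q = s
          induction s with
          | zero => simp
          | add x y hx hy => simp only [map_add, mul_add, TensorProduct.tmul_add, hx, hy]
          | tmul c d => simp
    rw [h1, Coalgebra.coassoc_apply]
    have h2 : ∀ t : H ⊗[K] H, TensorProduct.lift (LinearMap.mk₂ K (fun (a : H) (r : H ⊗[K] H) =>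
          (1 ⊗ₜ[K] S a) * LinearMap.rTensor H (LinearMap.mul' K H ∘ₗ LinearMap.rTensor H S)
    ((TensorProduct.assoc K H H H).symm (LinearMap.lTensor H Δ r)))
          (by intros; simp [TensorProduct.tmul_add, add_mul]) (by intros; simp)
          (by intros; simp [mul_add]) (by intros; simp)) (LinearMap.lTensor H Δ t) =
          1 ⊗ₜ LinearMap.mul' K H (LinearMap.rTensor H S t) := by
      intro t
      induction t with
      | zero => simp
      | add x y hx hy => simp only [map_add, TensorProduct.tmul_add, hx, hy]
      | tmul p q =>
        rw [LinearMap.lTensor_tmul, TensorProduct.lift.tmul, LinearMap.mk₂_apply, lam_comul]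
        simp
    rw [h2, HopfAlgebra.mul_antipode_rTensor_comul_apply]
    simp [Algebra.algebraMap_eq_smul_one, Algebra.TensorProduct.one_def]
  exact LinearMap.congr_fun h x

lemma Dop_antipode (x : H) : Dop (K := K) (S x) = TensorProduct.map S S (Δ x) := by
  rw [Dop_apply, comul_antipode, Dop_apply]
  generalize Δ x = t
  induction t with
  | zero => simp
  | add x y hx hy => simp only [map_add, hx, hy]
  | tmul a b => simp

variable (Si : H →ₗ[K] H)

lemma comul_Si (h1 : ∀ x, S (Si x) = x) (h2 : ∀ x, Si (S x) = x) (x : H) :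
    Δ (Si x) = TensorProduct.map Si Si (Dop (K := K) x) := by
  have : Dop (K := K) x = TensorProduct.map S S (Δ (Si x)) := by
    rw [← Dop_antipode, h1]
  rw [this]
  generalize Δ (Si x) = t
  induction t with
  | zero => simp
  | add x y hx hy => simp only [map_add, ← hx, ← hy]
  | tmul a b => simp [h2]

lemma Si_mul (h1 : ∀ x, S (Si x) = x) (h2 : ∀ x, Si (S x) = x) (x y : H) :
    Si (x * y) = Si y * Si x := by
  rw [← h2 (Si y * Si x), antipode_mul_antidistrib, h1, h1]

lemma Si_counit (h1 : ∀ x, S (Si x) = x) (h2 : ∀ x, Si (S x) = x) :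
    LinearMap.mul' K H ∘ₗ LinearMap.rTensor H Si ∘ₗ Dop (K := K) =
      Algebra.linearMap K H ∘ₗ counit := by
  ext x
  have := congrArg Si (HopfAlgebra.mul_antipode_rTensor_comul_apply (R := K) x)
  simp only [LinearMap.comp_apply, Dop_apply, Algebra.linearMap_apply]
  rw [Algebra.algebraMap_eq_smul_one, map_smul, show Si 1 = 1 by
    have h3 := h2 1
    rwa [antipode_one] at h3, ← Algebra.algebraMap_eq_smul_one] at this
  rw [← this]
  generalize Δ x = t
  induction t with
  | zero => simp
  | add x y hx hy => simp only [map_add, hx, hy]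
  | tmul a b => simp [Si_mul Si h1 h2, h2]

/-- `p ⊗ q ↦ f p • S q` -/
noncomputable def chi (f : Module.Dual K H) : H ⊗[K] H →ₗ[K] H :=
  (TensorProduct.lid K H).toLinearMap ∘ₗ TensorProduct.map f S

@[simp] lemma chi_tmul (f : Module.Dual K H) (p q : H) : chi f (p ⊗ₜ q) = f p • S q := by
  simp [chi]

lemma chi_add (f g : Module.Dual K H) (t : H ⊗[K] H) : chi (f + g) t = chi f t + chi g t := by
  induction t with
  | zero => simp
  | add x y hx hy => simp only [map_add, hx, hy]; abel
  | tmul a b => simp [add_smul]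

lemma chi_smul (c : K) (g : Module.Dual K H) (t : H ⊗[K] H) : chi (c • g) t = c • chi g t := by
  induction t with
  | zero => simp
  | add x y hx hy => simp only [map_add, hx, hy, smul_add]
  | tmul a b => simp [mul_smul]

/-- the coaction on the dual -/
noncomputable def del2 : Module.Dual K H →ₗ[K] H ⊗[K] Module.Dual K H where
  toFun f := curl (chi f ∘ₗ Δ)
  map_add' f g := by
    apply Sep.ext' sep_ev
    intro a
    simp [ev_curl, chi_add]
  map_smul' c g := by
    apply Sep.ext' sep_ev
    intro a
    simp [ev_curl, chi_smul]

lemma ev_del2 (f : Module.Dual K H) (a : H) : ev H a (del2 f) = chi f (Δ a) := by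
  simp [del2, ev_curl]

/-- the coaction on `X ⊗ X*` -/
noncomputable def del : H ⊗[K] Module.Dual K H →ₗ[K] H ⊗[K] (H ⊗[K] Module.Dual K H) :=
  LinearMap.rTensor (H ⊗[K] Module.Dual K H) (LinearMap.mul' K H) ∘ₗ
    (TensorProduct.tensorTensorTensorComm K H H H (Module.Dual K H)).toLinearMap ∘ₗ
      TensorProduct.map Dop del2

lemma ev_del (x : H) (f : Module.Dual K H) (a : H) :
    LinearMap.lTensor H (ev H a) (del (x ⊗ₜ f)) = Dop x * (chi f (Δ a) ⊗ₜ[K] 1) := by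
  rw [← ev_del2]
  simp only [del, LinearMap.comp_apply, TensorProduct.map_tmul]
  generalize (Dop x : H ⊗[K] H) = s
  generalize del2 f = t
  induction s with
  | zero => simp
  | add x y hx hy => simp only [TensorProduct.add_tmul, map_add, add_mul, hx, hy]
  | tmul p q =>
    induction t with
    | zero => simp
    | add x y hx hy =>
      simp only [TensorProduct.tmul_add, TensorProduct.add_tmul, map_add, mul_add, hx, hy]
    | tmul c d => simp [TensorProduct.smul_tmul]

lemma chi_coassoc (f : Module.Dual K H) (a : H) :
    TensorProduct.map (chi f ∘ₗ Δ) S (Δ a) = Dop (chi f (Δ a)) := by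
  have h1 : ∀ t : H ⊗[K] H, TensorProduct.map (chi f ∘ₗ Δ) S t =
     ((TensorProduct.lid K (H ⊗[K] H)).toLinearMap ∘ₗ TensorProduct.map f (TensorProduct.map S S)) (
      TensorProduct.assoc K H H H (LinearMap.rTensor H Δ t)) := by
    intro t
    induction t with
    | zero => simp
    | add x y hx hy => simp only [map_add, hx, hy]
    | tmul p q =>
      simp only [TensorProduct.map_tmul, LinearMap.comp_apply, LinearMap.rTensor_tmul]
      generalize Δ p = s
      induction s with
      | zero => simp
      | add x y hx hy => simp only [map_add, TensorProduct.add_tmul, hx, hy]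
      | tmul a b => simp [TensorProduct.smul_tmul']
  rw [h1, Coalgebra.coassoc_apply]
  generalize Δ a = t
  induction t with
  | zero => simp
  | add x y hx hy => simp only [map_add, hx, hy]
  | tmul p q => simp [Dop_antipode]

/-- `ev` as a linear map in the vector -/
noncomputable def evl : H ⊗[K] Module.Dual K H →ₗ[K] H →ₗ[K] H :=
  TensorProduct.lift LinearMap.smulRightₗ.flip

lemma evl_apply (t : H ⊗[K] Module.Dual K H) (a : H) : evl t a = ev H a t := by
  induction t with
  | zero => simp
  | add x y hx hy => simp only [map_add, LinearMap.add_apply, hx, hy]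
  | tmul p q => simp [evl]

lemma del_coassoc (w : H ⊗[K] Module.Dual K H) :
    LinearMap.lTensor H del (del w) = TensorProduct.assoc K H H _
      (LinearMap.rTensor _ (Dop (K := K)) (del w)) := by
  apply Sep.ext' ((sep_ev (K := K) (X := H) (M := H)).lTensor H |>.lTensor H)
  intro a
  induction w with
  | zero => simp
  | add x y hx hy => simp only [map_add, hx, hy]
  | tmul x f =>
    have hR : ∀ t : H ⊗[K] (H ⊗[K] Module.Dual K H),
        LinearMap.lTensor H (LinearMap.lTensor H (ev H a)) (TensorProduct.assoc K H H _
          (LinearMap.rTensor _ (Dop (K := K)) t)) = TensorProduct.assoc K H H _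
          (LinearMap.rTensor _ (Dop (K := K)) (LinearMap.lTensor H (ev H a) t)) := by
      intro t
      induction t with
      | zero => simp
      | add x y hx hy => simp only [map_add, hx, hy]
      | tmul p q =>
        simp only [LinearMap.rTensor_tmul, LinearMap.lTensor_tmul]
        generalize (Dop p : H ⊗[K] H) = s
        induction s with
        | zero => simp
        | add x y hx hy => simp only [map_add, TensorProduct.add_tmul, hx, hy]
        | tmul a b => simp
    have hL : LinearMap.lTensor H (LinearMap.lTensor H (ev H a))
        (LinearMap.lTensor H del (del (x ⊗ₜ f))) =
        LinearMap.lTensor H (Dop (K := K)) (Dop (K := K) x) *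
          TensorProduct.assoc K H H H (Dop (chi f (Δ a)) ⊗ₜ 1) := by
      have hφ : chi f ∘ₗ Δ = evl (del2 f) := by
        ext b; rw [evl_apply, ev_del2]; rfl
      rw [← chi_coassoc, hφ]
      simp only [del, LinearMap.comp_apply, TensorProduct.map_tmul]
      generalize (Dop x : H ⊗[K] H) = s
      generalize del2 f = t
      induction s with
      | zero => simp
      | add x y hx hy => simp only [TensorProduct.add_tmul, map_add, add_mul, hx, hy]
      | tmul p q =>
        induction t with
        | zero => simp
        | add x y hx hy =>
          simp only [TensorProduct.tmul_add, TensorProduct.add_tmul, map_add, mul_add, hx, hy,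
            TensorProduct.map_add_left, LinearMap.add_apply]
        | tmul c g =>
          have := ev_del q g a
          simp only [TensorProduct.tensorTensorTensorComm_tmul, LinearEquiv.coe_coe,
            LinearMap.rTensor_tmul, LinearMap.lTensor_tmul, LinearMap.mul'_apply]
          simp only [← LinearMap.comp_apply, ← LinearMap.comp_assoc] at this ⊢
          simp only [del, LinearMap.comp_apply, TensorProduct.map_tmul] at this ⊢
          rw [this]
          generalize (Dop q : H ⊗[K] H) = s
          generalize Δ a = t
          induction t with
          | zero => simp
          | add x y hx hy =>
            simp only [TensorProduct.tmul_add, TensorProduct.add_tmul, map_add, mul_add, hx, hy]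
          | tmul b d =>
            induction s with
            | zero => simp
            | add x y hx hy =>
              simp only [TensorProduct.tmul_add, add_mul, hx, hy]
            | tmul p' q' =>
              simp only [evl_apply, ev_tmul, TensorProduct.map_tmul, chi_tmul,
                TensorProduct.assoc_tmul, Algebra.TensorProduct.tmul_mul_tmul, mul_one,
                mul_smul_comm]
              simp only [← TensorProduct.smul_tmul', TensorProduct.tmul_smul]
    rw [hL, hR, ev_del]
    rw [Dop_coassoc]
    generalize (Dop x : H ⊗[K] H) = s
    generalize chi f (Δ a) = c
    induction s with
    | zero => simp
    | add x y hx hy => simp only [map_add, add_mul, hx, hy]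
    | tmul p q =>
      simp only [LinearMap.rTensor_tmul, Algebra.TensorProduct.tmul_mul_tmul, mul_one, Dop_mul]
      generalize (Dop p : H ⊗[K] H) = s
      generalize (Dop c : H ⊗[K] H) = t
      induction s with
      | zero => simp
      | add x y hx hy => simp only [map_add, TensorProduct.add_tmul, add_mul, hx, hy]
      | tmul p q =>
        induction t with
        | zero => simp
        | add x y hx hy => simp only [map_add, TensorProduct.add_tmul, mul_add, hx, hy]
        | tmul c d => simp

/-- right action of `H` on its dual -/
noncomputable def dact : H →ₗ[K] Module.Dual K H →ₗ[K] Module.Dual K H :=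
  Module.Dual.transpose (R := K) (M := H) (M' := H) ∘ₗ LinearMap.mul K H

@[simp] lemma dact_apply (s y : H) (f : Module.Dual K H) : dact s f y = f (s * y) := rfl

/-- `k₁ ⊗ k₂` acts by `k₂` on `X` and by `Si k₁` on `X*` -/
noncomputable def theta : H ⊗[K] H →ₗ[K] (H ⊗[K] Module.Dual K H) →ₗ[K] H ⊗[K] Module.Dual K H :=
  TensorProduct.lift ((TensorProduct.mapBilinear (RingHom.id K) H (Module.Dual K H) H
    (Module.Dual K H)).compl₁₂ (LinearMap.mul K H) (dact ∘ₗ Si)).flip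

lemma theta_tmul (k l y : H) (g : Module.Dual K H) :
    theta Si (k ⊗ₜ l) (y ⊗ₜ g) = (l * y) ⊗ₜ dact (Si k) g := by
  simp [theta]

/-- the action on `X ⊗ X*` -/
noncomputable def act : H →ₗ[K] (H ⊗[K] Module.Dual K H) →ₗ[K] H ⊗[K] Module.Dual K H :=
  theta Si ∘ₗ Δ

lemma theta_mul (h1 : ∀ x, S (Si x) = x) (h2 : ∀ x, Si (S x) = x) (s t : H ⊗[K] H)
    (w : H ⊗[K] Module.Dual K H) : theta Si (s * t) w = theta Si s (theta Si t w) := by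
  induction s with
  | zero => simp
  | add x y hx hy => simp only [add_mul, map_add, LinearMap.add_apply, hx, hy]
  | tmul a b =>
    induction t with
    | zero => simp
    | add x y hx hy => simp only [mul_add, map_add, LinearMap.add_apply, hx, hy]
    | tmul c d =>
      induction w with
      | zero => simp
      | add x y hx hy => simp only [map_add, hx, hy]
      | tmul y g =>
        rw [Algebra.TensorProduct.tmul_mul_tmul, theta_tmul, theta_tmul, theta_tmul, mul_assoc]
        congr 1
        ext z
        simp [Si_mul Si h1 h2, mul_assoc]

lemma act_mul (h1 : ∀ x, S (Si x) = x) (h2 : ∀ x, Si (S x) = x) (h k : H)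
    (w : H ⊗[K] Module.Dual K H) : act Si (h * k) w = act Si h (act Si k w) := by
  simp only [act, LinearMap.comp_apply, Bialgebra.comul_mul, theta_mul Si h1 h2]

/-- auxiliary map `h₁ ⊗ h₂ ↦ c(g ∘ Si h₂, a) h₁` -/
noncomputable def QQ (g : Module.Dual K H) (Z : H ⊗[K] H) : H ⊗[K] H →ₗ[K] H :=
  TensorProduct.lift (LinearMap.mk₂ K (fun h k => chi (dact (Si k) g) Z * h)
    (by intros; simp [mul_add]) (by intros; simp)
    (by intros; simp [chi_add, add_mul]) (by intros; simp [chi_smul]))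

lemma QQ_tmul (g : Module.Dual K H) (Z : H ⊗[K] H) (h k : H) :
    QQ Si g Z (h ⊗ₜ k) = chi (dact (Si k) g) Z * h := by
  simp [QQ]

lemma chi_Si (h1 : ∀ x, S (Si x) = x) (h2 : ∀ x, Si (S x) = x) (g : Module.Dual K H) (k a : H) :
    chi g (Δ (Si k * a)) = QQ Si g (Δ a) (Δ k) := by
  rw [Bialgebra.comul_mul, comul_Si Si h1 h2, Dop_apply]
  generalize Δ a = Z
  generalize Δ k = t
  induction t with
  | zero => simp
  | add x y hx hy => simp only [map_add, add_mul, hx, hy]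
  | tmul p q =>
    rw [QQ_tmul]
    induction Z with
    | zero => simp
    | add x y hx hy => simp only [map_add, mul_add, add_mul, hx, hy]
    | tmul c d => simp [antipode_mul_antidistrib, h1]

lemma ev_theta (a k l : H) (w : H ⊗[K] Module.Dual K H) :
    ev H a (theta Si (k ⊗ₜ l) w) = l * ev H (Si k * a) w := by
  induction w with
  | zero => simp
  | add x y hx hy => simp only [map_add, mul_add, hx, hy]
  | tmul y g => rw [theta_tmul]; simp

/-- auxiliary map `h₁ ⊗ (h₂ ⊗ h₃) ↦ (h₃ ⊗ h₂) D (q h₁ ⊗ 1)` -/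
noncomputable def RR (q : H →ₗ[K] H) (D : H ⊗[K] H) : H ⊗[K] (H ⊗[K] H) →ₗ[K] H ⊗[K] H :=
  TensorProduct.lift (LinearMap.mk₂ K (fun h t => TensorProduct.comm K H H t * D * (q h ⊗ₜ 1))
    (by intros; simp [mul_add, TensorProduct.add_tmul])
    (by intros; simp [← TensorProduct.smul_tmul'])
    (by intros; simp [add_mul]) (by intros; simp))

lemma RR_tmul (q : H →ₗ[K] H) (D : H ⊗[K] H) (h : H) (t : H ⊗[K] H) :
    RR q D (h ⊗ₜ t) = TensorProduct.comm K H H t * D * (q h ⊗ₜ 1) := by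
  simp [RR]

lemma yd_right (h1 : ∀ x, S (Si x) = x) (h2 : ∀ x, Si (S x) = x) (h a y : H)
    (g : Module.Dual K H) :
    LinearMap.lTensor H (ev H a) (Z2 (act Si) del (y ⊗ₜ g) (Δ h)) =
      RR (QQ Si g (Δ a) ∘ₗ Δ) (Dop y) (LinearMap.lTensor H Δ (Δ h)) := by
  rw [← Coalgebra.coassoc_apply]
  generalize Δ h = t
  induction t with
  | zero => simp
  | add x y hx hy => simp only [map_add, hx, hy]
  | tmul p q =>
    rw [Z2_tmul, act, LinearMap.comp_apply, LinearMap.rTensor_tmul]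
    generalize Δ p = s
    induction s with
    | zero => simp
    | add x y hx hy =>
      simp only [map_add, TensorProduct.map_add_right, LinearMap.add_apply,
        TensorProduct.add_tmul, hx, hy]
    | tmul k l =>
      rw [TensorProduct.assoc_tmul, RR_tmul, LinearMap.comp_apply, ← chi_Si Si h1 h2, mul_assoc,
        ← ev_del]
      generalize del (y ⊗ₜ[K] g) = w
      induction w with
      | zero => simp
      | add x y hx hy => simp only [map_add, mul_add, hx, hy]
      | tmul b w => simp [ev_theta]

lemma yd_left (h a y : H) (g : Module.Dual K H) :
    LinearMap.lTensor H (ev H a) (Z1 (act Si) del (y ⊗ₜ g) (Δ h)) =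
      RR (QQ Si g (Δ a) ∘ₗ Δ) (Dop y) (LinearMap.lTensor H Δ (Δ h)) := by
  have hA : ∀ t : H ⊗[K] H,
    LinearMap.lTensor H (ev H a) (Z1 (act Si) del (y ⊗ₜ g) t) =
    TensorProduct.lift (LinearMap.mk₂ K (fun s k => Dop k * Dop y * (QQ Si g (Δ a) s ⊗ₜ 1))
      (by intros; simp [mul_add, TensorProduct.add_tmul])
      (by intros; simp [← TensorProduct.smul_tmul'])
      (by intros; simp [add_mul]) (by intros; simp))
      ((TensorProduct.assoc K H H H).symm (LinearMap.lTensor H Δ t)) := by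
    intro t
    induction t with
    | zero => simp
    | add x y hx hy => simp only [map_add, hx, hy]
    | tmul p q =>
      rw [Z1_tmul, act, LinearMap.comp_apply, LinearMap.lTensor_tmul]
      generalize Δ q = s
      induction s with
      | zero => simp
      | add x y hx hy =>
        simp only [map_add, LinearMap.add_apply, TensorProduct.tmul_add, hx, hy]
      | tmul k l =>
        have hB : ∀ t : H ⊗[K] (H ⊗[K] Module.Dual K H), LinearMap.lTensor H (ev H a)
          (LinearMap.rTensor _ (LinearMap.mulRight K p) t) =
            LinearMap.lTensor H (ev H a) t * (p ⊗ₜ 1) := by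
          intro t
          induction t with
          | zero => simp
          | add x y hx hy => simp only [map_add, add_mul, hx, hy]
          | tmul p q => simp
        rw [theta_tmul, hB, ev_del, TensorProduct.assoc_symm_tmul, TensorProduct.lift.tmul,
          LinearMap.mk₂_apply, QQ_tmul, Dop_mul, mul_assoc (Dop l * Dop y)]
        simp
  rw [hA, Coalgebra.coassoc_symm_apply]
  generalize Δ h = t
  induction t with
  | zero => simp
  | add x y hx hy => simp only [map_add, hx, hy]
  | tmul p q => simp [RR_tmul, Dop_apply]

lemma yd_compat (h1 : ∀ x, S (Si x) = x) (h2 : ∀ x, Si (S x) = x) (h : H)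
    (w : H ⊗[K] Module.Dual K H) :
    Z1 (act Si) del w (Δ h) = Z2 (act Si) del w (Δ h) := by
  apply Sep.ext' ((sep_ev (K := K) (X := H) (M := H)).lTensor H)
  intro a
  induction w with
  | zero =>
    generalize Δ h = t
    induction t with
    | zero => simp
    | add x y hx hy => simp only [map_add, hx, hy]
    | tmul p q => simp [Z1_tmul, Z2_tmul]
  | add x y hx hy =>
    have e1 : Z1 (act Si) del (x + y) (Δ h) = Z1 (act Si) del x (Δ h) + Z1 (act Si) del y (Δ h) := by
      generalize Δ h = t
      induction t with
      | zero => simp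
      | add x y hx hy => simp only [map_add, hx, hy]; abel
      | tmul p q => simp [Z1_tmul]
    have e2 : Z2 (act Si) del (x + y) (Δ h) = Z2 (act Si) del x (Δ h) + Z2 (act Si) del y (Δ h) := by
      simp [Z2]
    rw [e1, e2, map_add, map_add, hx, hy]
  | tmul y g => rw [yd_left, yd_right Si h1 h2]

lemma ybe_act (h1 : ∀ x, S (Si x) = x) (h2 : ∀ x, Si (S x) = x) :
    W1 (ydb (act Si) del) ∘ₗ W2 (ydb (act Si) del) ∘ₗ W1 (ydb (act Si) del) =
    W2 (ydb (act Si) del) ∘ₗ W1 (ydb (act Si) del) ∘ₗ W2 (ydb (act Si) del) :=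
  ybe_of_yd (act Si) del (act_mul Si h1 h2) del_coassoc (yd_compat Si h1 h2)

lemma tau_tmul (x z : H) : τ (K := K) (x ⊗ₜ z) =
    LinearMap.rTensor H (LinearMap.mulRight K z) (Dop (K := K) x) := by
  simp only [τ, LinearMap.comp_apply, LinearMap.rTensor_tmul, Dop_apply]
  generalize Δ x = t
  induction t with
  | zero => simp
  | add x y hx hy => simp only [map_add, TensorProduct.add_tmul, hx, hy]
  | tmul p q => simp

lemma rp_tau (f : Module.Dual K H) (x : H) : rp (K := K) (τ (K := K) (H := H)) (f ⊗ₜ x) =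
    LinearMap.lTensor H (dact.flip f) (Δ x) := by
  apply Sep.ext' sep_ev
  intro a
  rw [ev_rp, tau_tmul, Dop_apply]
  generalize Δ x = t
  induction t with
  | zero => simp
  | add x y hx hy => simp only [map_add, hx, hy]
  | tmul p q => simp

/-- inverse of the partial transpose of `τ` -/
noncomputable def uu : H ⊗[K] Module.Dual K H →ₗ[K] Module.Dual K H ⊗[K] H :=
  TensorProduct.lift ((LinearMap.rTensorHom H ∘ₗ (dact ∘ₗ Si).flip).flip ∘ₗ Dop)

lemma uu_tmul (x : H) (f : Module.Dual K H) :
    uu Si (x ⊗ₜ f) = LinearMap.rTensor H (dact.flip f ∘ₗ Si) (Dop x) := by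
  simp only [uu, TensorProduct.lift.tmul]
  rfl

lemma rp_tau_uu (h1 : ∀ x, S (Si x) = x) (h2 : ∀ x, Si (S x) = x) :
    rp (K := K) (τ (K := K) (H := H)) ∘ₗ uu Si = LinearMap.id := by
  apply TensorProduct.ext'
  intro x f
  rw [LinearMap.comp_apply, uu_tmul, Dop_apply]
  have hA : ∀ t : H ⊗[K] H, rp (K := K) (τ (K := K) (H := H))
      (LinearMap.rTensor H (dact.flip f ∘ₗ Si) (TensorProduct.comm K H H t)) =
      LinearMap.lTensor H (dact.flip f ∘ₗ LinearMap.mul' K H ∘ₗ LinearMap.rTensor H Si ∘ₗ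
        (TensorProduct.comm K H H).toLinearMap)
        (TensorProduct.assoc K H H H (LinearMap.rTensor H Δ t)) := by
    intro t
    induction t with
    | zero => simp
    | add x y hx hy => simp only [map_add, hx, hy]
    | tmul p q =>
      simp only [TensorProduct.comm_tmul, LinearMap.rTensor_tmul, rp_tau]
      generalize Δ p = s
      induction s with
      | zero => simp
      | add x y hx hy => simp only [map_add, TensorProduct.add_tmul, hx, hy]
      | tmul a b =>
        simp only [LinearMap.lTensor_tmul, TensorProduct.assoc_tmul, LinearMap.comp_apply,
          LinearEquiv.coe_coe, TensorProduct.comm_tmul, LinearMap.rTensor_tmul,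
          LinearMap.mul'_apply]
        congr 1
        ext z
        simp [mul_assoc]
  rw [hA, Coalgebra.coassoc_apply, ← LinearMap.comp_apply, ← LinearMap.lTensor_comp]
  have hB : (dact.flip f ∘ₗ LinearMap.mul' K H ∘ₗ LinearMap.rTensor H Si ∘ₗ
        (TensorProduct.comm K H H).toLinearMap) ∘ₗ Δ =
      (dact.flip f ∘ₗ Algebra.linearMap K H) ∘ₗ counit := by
    calc _ = dact.flip f ∘ₗ (LinearMap.mul' K H ∘ₗ LinearMap.rTensor H Si ∘ₗ Dop (K := K)) := rfl
      _ = _ := by rw [Si_counit Si h1 h2]; rfl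
  rw [hB, LinearMap.lTensor_comp, LinearMap.comp_apply, Coalgebra.lTensor_counit_comul]
  simp only [LinearMap.lTensor_tmul, LinearMap.id_apply]
  congr 1
  ext z
  simp

lemma tau_inv (τi : H ⊗[K] H →ₗ[K] H ⊗[K] H)
    (hτ2 : τi ∘ₗ τ (K := K) (H := H) = LinearMap.id) (y a : H) :
    τi (y ⊗ₜ a) = LinearMap.lTensor H (LinearMap.mulRight K y ∘ₗ S) (Δ a) := by
  have key : τ (K := K) (LinearMap.lTensor H (LinearMap.mulRight K y ∘ₗ S) (Δ a)) = y ⊗ₜ a := by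
    have hA : ∀ t : H ⊗[K] H, τ (K := K) (LinearMap.lTensor H (LinearMap.mulRight K y ∘ₗ S) t) =
      TensorProduct.comm K H H (LinearMap.lTensor H (LinearMap.mulRight K y ∘ₗ
        LinearMap.mul' K H ∘ₗ LinearMap.lTensor H S) (TensorProduct.assoc K H H H
          (LinearMap.rTensor H Δ t))) := by
      intro t
      induction t with
      | zero => simp
      | add x y hx hy => simp only [map_add, hx, hy]
      | tmul p q =>
        simp only [LinearMap.lTensor_tmul, LinearMap.rTensor_tmul, tau_tmul, Dop_apply]
        generalize Δ p = s
        induction s with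
        | zero => simp
        | add x y hx hy => simp only [map_add, TensorProduct.add_tmul, hx, hy]
        | tmul a b => simp [mul_assoc]
    rw [hA, Coalgebra.coassoc_apply, ← LinearMap.comp_apply (LinearMap.lTensor H _),
      ← LinearMap.lTensor_comp, LinearMap.comp_assoc, LinearMap.comp_assoc,
      HopfAlgebra.mul_antipode_lTensor_comul, ← LinearMap.comp_assoc, LinearMap.lTensor_comp,
      LinearMap.comp_apply, Coalgebra.lTensor_counit_comul]
    simp
  rw [← key, ← LinearMap.comp_apply, hτ2]
  rfl

lemma rp_tau_inv (τi : H ⊗[K] H →ₗ[K] H ⊗[K] H)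
    (hτ2 : τi ∘ₗ τ (K := K) (H := H) = LinearMap.id) (f : Module.Dual K H) (y : H) :
    rp (K := K) τi (f ⊗ₜ y) = LinearMap.rTensor _ (LinearMap.mulRight K y) (del2 f) := by
  apply Sep.ext' sep_ev
  intro a
  rw [ev_rp, tau_inv τi hτ2, ev_rTensor, ev_del2]
  generalize Δ a = t
  induction t with
  | zero => simp
  | add x y hx hy => simp only [map_add, hx, hy]
  | tmul p q => simp

/-- pairing of `X* ⊗ X*` with `X ⊗ X` -/
lemma ev_rprp (f : H ⊗[K] H →ₗ[K] H ⊗[K] H) (θ : Module.Dual K H ⊗[K] Module.Dual K H) (a b : H) :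
    ev (Module.Dual K H) a (rp (K := K) (rp (K := K) f) θ) b =
      TensorProduct.dualDistrib K H H (TensorProduct.comm K _ _ θ) (f (a ⊗ₜ b)) := by
  induction θ with
  | zero => simp
  | add x y hx hy => simp only [map_add, LinearMap.add_apply, hx, hy]
  | tmul φ ψ =>
    rw [ev_rp]
    have h1 : ∀ t : H ⊗[K] Module.Dual K H, TensorProduct.lid K (Module.Dual K H)
        (LinearMap.rTensor (Module.Dual K H) φ t) b = φ (ev H b t) := by
      intro t
      induction t with
      | zero => simp
      | add x y hx hy => simp only [map_add, LinearMap.add_apply, hx, hy]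
      | tmul p q => simp [mul_comm]
    rw [h1, ev_rp]
    generalize f (a ⊗ₜ b) = s
    induction s with
    | zero => simp
    | add x y hx hy => simp only [map_add, hx, hy]
    | tmul p q => simp

lemma rprp_comp (f g : H ⊗[K] H →ₗ[K] H ⊗[K] H) (hfg : g ∘ₗ f = LinearMap.id) :
    rp (K := K) (rp (K := K) f) ∘ₗ rp (K := K) (rp (K := K) g) = LinearMap.id := by
  apply LinearMap.ext
  intro θ
  apply Sep.ext' sep_ev
  intro a
  ext b
  rw [LinearMap.comp_apply, ev_rprp]
  have h1 : ∀ t : H ⊗[K] H, TensorProduct.dualDistrib K H H (TensorProduct.comm K _ _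
      (rp (K := K) (rp (K := K) g) θ)) t =
      TensorProduct.dualDistrib K H H (TensorProduct.comm K _ _ θ) (g t) := by
    intro t
    induction t with
    | zero => simp
    | add x y hx hy => simp only [map_add, hx, hy]
    | tmul p q =>
      rw [← ev_rprp]
      generalize rp (K := K) (rp (K := K) g) θ = s
      induction s with
      | zero => simp
      | add x y hx hy => simp only [map_add, LinearMap.add_apply, hx, hy]
      | tmul p q => simp [mul_comm]
  rw [h1, ← LinearMap.comp_apply g f, hfg, LinearMap.id_apply, LinearMap.id_apply]
  generalize θ = s
  induction s with
  | zero => simp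
  | add x y hx hy => simp only [map_add, LinearMap.add_apply, hx, hy]
  | tmul p q => simp [mul_comm]

lemma inn_inn' (g : Module.Dual K H ⊗[K] H →ₗ[K] H ⊗[K] Module.Dual K H)
    (g' : H ⊗[K] Module.Dual K H →ₗ[K] Module.Dual K H ⊗[K] H) (h : g ∘ₗ g' = LinearMap.id) :
    inn g ∘ₗ inn' g' = LinearMap.id := by
  have e1 : ∀ z, LinearMap.rTensor (Module.Dual K H) g (LinearMap.rTensor (Module.Dual K H) g' z)
      = z := by
    intro z
    rw [← LinearMap.comp_apply, ← LinearMap.rTensor_comp, h, LinearMap.rTensor_id]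
    rfl
  apply LinearMap.ext
  intro z
  simp only [inn, inn', LinearMap.comp_apply, LinearEquiv.coe_coe, LinearEquiv.apply_symm_apply,
    LinearMap.id_apply]
  rw [LinearEquiv.symm_apply_eq, ← LinearMap.comp_apply, ← LinearMap.lTensor_comp]
  refine (LinearMap.congr_fun (g := LinearMap.id) ?_ _)
  rw [← LinearMap.lTensor_id]
  congr 1
  apply LinearMap.ext
  intro z
  simp only [LinearMap.comp_apply, LinearEquiv.coe_coe, LinearEquiv.symm_apply_apply, e1,
    LinearEquiv.apply_symm_apply, LinearMap.id_apply]

lemma inn'_inn (g : Module.Dual K H ⊗[K] H →ₗ[K] H ⊗[K] Module.Dual K H)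
    (g' : H ⊗[K] Module.Dual K H →ₗ[K] Module.Dual K H ⊗[K] H) (h : g' ∘ₗ g = LinearMap.id) :
    inn' g' ∘ₗ inn g = LinearMap.id := by
  have e1 : ∀ z, LinearMap.rTensor (Module.Dual K H) g' (LinearMap.rTensor (Module.Dual K H) g z)
      = z := by
    intro z
    rw [← LinearMap.comp_apply, ← LinearMap.rTensor_comp, h, LinearMap.rTensor_id]
    rfl
  apply LinearMap.ext
  intro z
  simp only [inn, inn', LinearMap.comp_apply, LinearEquiv.coe_coe, LinearEquiv.apply_symm_apply,
    LinearMap.id_apply]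
  rw [LinearEquiv.symm_apply_eq, ← LinearMap.comp_apply, ← LinearMap.lTensor_comp]
  refine (LinearMap.congr_fun (g := LinearMap.id) ?_ _)
  rw [← LinearMap.lTensor_id]
  congr 1
  apply LinearMap.ext
  intro z
  simp only [LinearMap.comp_apply, LinearEquiv.coe_coe, LinearEquiv.symm_apply_apply, e1,
    LinearEquiv.apply_symm_apply, LinearMap.id_apply]

lemma rho_comp (t ti : H ⊗[K] H →ₗ[K] H ⊗[K] H)
    (t' ti' : Module.Dual K H ⊗[K] Module.Dual K H →ₗ[K] Module.Dual K H ⊗[K] Module.Dual K H)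
    (a b : Module.Dual K H ⊗[K] H →ₗ[K] H ⊗[K] Module.Dual K H)
    (u v : H ⊗[K] Module.Dual K H →ₗ[K] Module.Dual K H ⊗[K] H)
    (h1 : t ∘ₗ ti = LinearMap.id) (h2 : t' ∘ₗ ti' = LinearMap.id)
    (h3 : a ∘ₗ v = LinearMap.id) (h4 : u ∘ₗ b = LinearMap.id) :
    rho t t' a u ∘ₗ rho ti ti' b v = LinearMap.id := by
  have e1 := inn_inn' a v h3
  have e2 := inn'_inn b u h4
  have e3 : TensorProduct.map t t' ∘ₗ TensorProduct.map ti ti' = LinearMap.id := by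
    rw [← TensorProduct.map_comp, h1, h2, TensorProduct.map_id]
  apply LinearMap.ext; intro z
  simp only [rho, LinearMap.comp_apply]
  have e1' := fun z => LinearMap.congr_fun e1 z
  have e2' := fun z => LinearMap.congr_fun e2 z
  have e3' := fun z => LinearMap.congr_fun e3 z
  simp only [LinearMap.comp_apply, LinearMap.id_apply] at e1' e2' e3'
  rw [e1', e3', e2']
  rfl

lemma act_eq (k z : H) (g : Module.Dual K H) : act Si k (z ⊗ₜ g) =
    TensorProduct.map (LinearMap.mulRight K z) (dact.flip g ∘ₗ Si) (Dop (K := K) k) := by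
  rw [act, LinearMap.comp_apply, Dop_apply]
  generalize Δ k = t
  induction t with
  | zero => simp
  | add x y hx hy => simp only [map_add, LinearMap.add_apply, hx, hy]
  | tmul p q => rw [theta_tmul]; simp

lemma act_chi (h2 : ∀ x, Si (S x) = x) (f g : Module.Dual K H) (a y : H) :
    act Si (chi f (Δ a)) (y ⊗ₜ g) =
    TensorProduct.map (LinearMap.mulRight K y ∘ₗ evl (del2 f)) (dact.flip g) (Δ a) := by
  have hφ : chi f ∘ₗ Δ = evl (del2 f) := by
    ext b; rw [evl_apply, ev_del2]; rfl
  rw [act_eq, ← chi_coassoc, hφ]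
  generalize Δ a = t
  induction t with
  | zero => simp
  | add x y hx hy => simp only [map_add, hx, hy]
  | tmul p q => simp [h2]

lemma UU_tau (x z : H) (g : Module.Dual K H) :
    (TensorProduct.assoc K H (Module.Dual K H) H).symm
      (LinearMap.lTensor H (uu Si ∘ₗ (TensorProduct.mk K H (Module.Dual K H)).flip g)
        (τ (K := K) (x ⊗ₜ z))) =
    LinearMap.rTensor H ((act Si).flip (z ⊗ₜ g)) (Dop (K := K) x) := by
  rw [tau_tmul]
  have hA : ∀ t : H ⊗[K] H, LinearMap.lTensor H (uu Si ∘ₗ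
      (TensorProduct.mk K H (Module.Dual K H)).flip g)
        (LinearMap.rTensor H (LinearMap.mulRight K z) t) =
      TensorProduct.map (LinearMap.mulRight K z) (LinearMap.rTensor H (dact.flip g ∘ₗ Si))
        (LinearMap.lTensor H (Dop (K := K)) t) := by
    intro t
    induction t with
    | zero => simp
    | add x y hx hy => simp only [map_add, hx, hy]
    | tmul p q => simp [uu_tmul]
  have hB : ∀ t : H ⊗[K] H, (TensorProduct.assoc K H (Module.Dual K H) H).symm
      (TensorProduct.map (LinearMap.mulRight K z) (LinearMap.rTensor H (dact.flip g ∘ₗ Si))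
        (TensorProduct.assoc K H H H (LinearMap.rTensor H (Dop (K := K)) t))) =
      LinearMap.rTensor H ((act Si).flip (z ⊗ₜ g)) t := by
    intro t
    induction t with
    | zero => simp
    | add x y hx hy => simp only [map_add, hx, hy]
    | tmul p q =>
      rw [LinearMap.rTensor_tmul, LinearMap.rTensor_tmul, LinearMap.flip_apply, act_eq]
      generalize (Dop p : H ⊗[K] H) = s
      induction s with
      | zero => simp
      | add x y hx hy => simp only [map_add, TensorProduct.add_tmul, hx, hy]
      | tmul a b => simp
  rw [hA, Dop_coassoc, hB]

lemma ev_inn' (u : H ⊗[K] Module.Dual K H →ₗ[K] Module.Dual K H ⊗[K] H) (a : H)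
    (p : H ⊗[K] H) (θ : Module.Dual K H ⊗[K] Module.Dual K H) :
    LinearMap.lTensor (H ⊗[K] Module.Dual K H) (ev H a) (inn' u (p ⊗ₜ θ)) =
    (TensorProduct.assoc K H (Module.Dual K H) H).symm
      (LinearMap.lTensor H (u ∘ₗ (TensorProduct.mk K H (Module.Dual K H)).flip
        (ev (Module.Dual K H) a θ)) p) := by
  induction p with
  | zero => simp
  | add x y hx hy => simp only [map_add, TensorProduct.add_tmul, hx, hy]
  | tmul p q =>
    simp only [inn', LinearMap.comp_apply, LinearEquiv.coe_coe, TensorProduct.assoc_tmul,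
      LinearMap.lTensor_tmul, LinearMap.flip_apply, TensorProduct.mk_apply]
    induction θ with
    | zero => simp
    | add x y hx hy => simp only [map_add, TensorProduct.tmul_add, hx, hy]
    | tmul φ ψ =>
      simp only [TensorProduct.assoc_symm_tmul, LinearMap.rTensor_tmul, ev_tmul,
        TensorProduct.tmul_smul, map_smul]
      generalize u (q ⊗ₜ φ) = s
      induction s with
      | zero => simp
      | add x y hx hy =>
        simp only [map_add, TensorProduct.add_tmul, TensorProduct.tmul_add, smul_add, hx, hy]
      | tmul a b => simp

lemma ev_rprp_tau (f g : Module.Dual K H) (a : H) :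
    ev (Module.Dual K H) a (rp (K := K) (rp (K := K) (τ (K := K) (H := H))) (f ⊗ₜ g)) =
      TensorProduct.lid K (Module.Dual K H) (TensorProduct.map f (dact.flip g) (Δ a)) := by
  rw [ev_rp, rp_tau]
  generalize Δ a = t
  induction t with
  | zero => simp
  | add x y hx hy => simp only [map_add, hx, hy]
  | tmul p q => simp

lemma rho_left (x y a : H) (g : Module.Dual K H) (s : H ⊗[K] Module.Dual K H) :
    LinearMap.lTensor (H ⊗[K] Module.Dual K H) (ev H a) (inn' (uu Si)
      (TensorProduct.map (τ (K := K)) (rp (K := K) (rp (K := K) (τ (K := K) (H := H))))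
      ((TensorProduct.assoc K H H (Module.Dual K H ⊗[K] Module.Dual K H)).symm
        (x ⊗ₜ TensorProduct.assoc K H (Module.Dual K H) (Module.Dual K H)
          (LinearMap.rTensor _ (LinearMap.mulRight K y) s ⊗ₜ g))))) =
    LinearMap.rTensor H ((act Si).flip (TensorProduct.map (LinearMap.mulRight K y ∘ₗ evl s)
      (dact.flip g) (Δ a))) (Dop (K := K) x) := by
  induction s with
  | zero => simp
  | add p q hp hq =>
    simp only [map_add, TensorProduct.add_tmul, TensorProduct.tmul_add, hp, hq,
      LinearMap.comp_add, TensorProduct.map_add_left, LinearMap.add_apply,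
      LinearMap.rTensor_add]
  | tmul c f =>
    simp only [LinearMap.rTensor_tmul, TensorProduct.assoc_tmul, TensorProduct.assoc_symm_tmul,
      TensorProduct.map_tmul]
    rw [ev_inn', UU_tau, ev_rprp_tau]
    congr 3
    generalize Δ a = t
    induction t with
    | zero => simp
    | add x y hx hy => simp only [map_add, TensorProduct.tmul_add, hx, hy]
    | tmul p q =>
      simp [evl_apply, TensorProduct.tmul_smul, ← TensorProduct.smul_tmul']

lemma rho_right (h1 : ∀ x, S (Si x) = x) (h2 : ∀ x, Si (S x) = x) (x a : H)
    (f : Module.Dual K H) (w : H ⊗[K] Module.Dual K H) :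
    LinearMap.lTensor (H ⊗[K] Module.Dual K H) (ev H a) (LinearMap.rTensor _ ((act Si).flip w)
      (del (x ⊗ₜ f))) =
    LinearMap.rTensor H ((act Si).flip (act Si (chi f (Δ a)) w)) (Dop (K := K) x) := by
  have hA : ∀ t : H ⊗[K] (H ⊗[K] Module.Dual K H),
      LinearMap.lTensor (H ⊗[K] Module.Dual K H) (ev H a)
        (LinearMap.rTensor _ ((act Si).flip w) t) =
      LinearMap.rTensor _ ((act Si).flip w) (LinearMap.lTensor _ (ev H a) t) := by
    intro t
    induction t with
    | zero => simp
    | add x y hx hy => simp only [map_add, hx, hy]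
    | tmul p q => simp
  rw [hA, ev_del]
  generalize (Dop x : H ⊗[K] H) = s
  induction s with
  | zero => simp
  | add x y hx hy => simp only [map_add, add_mul, hx, hy]
  | tmul p q => simp [act_mul Si h1 h2]

lemma rho_eq (h1 : ∀ x, S (Si x) = x) (h2 : ∀ x, Si (S x) = x) (τi : H ⊗[K] H →ₗ[K] H ⊗[K] H)
    (hτ2 : τi ∘ₗ τ (K := K) (H := H) = LinearMap.id) :
    rho (τ (K := K) (H := H)) (rp (K := K) (rp (K := K) (τ (K := K)))) (rp (K := K) τi) (uu Si) =
      ydb (act Si) del := by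
  apply TensorProduct.ext'
  intro w w'
  induction w with
  | zero => simp
  | add p q hp hq => simp only [map_add, TensorProduct.add_tmul, hp, hq]
  | tmul x f =>
    induction w' with
    | zero => simp
    | add p q hp hq => simp only [map_add, TensorProduct.tmul_add, hp, hq]
    | tmul y g =>
      apply Sep.ext' ((sep_ev (K := K) (X := H) (M := H)).lTensor _)
      intro a
      rw [ydb_tmul, rho_right Si h1 h2, act_chi Si h2, ← rho_left]
      simp only [rho, inn, LinearMap.comp_apply, LinearEquiv.coe_coe, TensorProduct.assoc_tmul,
        LinearMap.lTensor_tmul, TensorProduct.assoc_symm_tmul, LinearMap.rTensor_tmul,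
        rp_tau_inv τi hτ2]

end Hopf

end Helpers

/-- for a finite-dimensional Hopf algebra `H` over `K` with invertible
antipode, the map `ρ_τ = (1 ⊗ (r_p τ)⁻¹ ⊗ 1) ∘ (τ ⊗ r_p(r_p τ)) ∘ (1 ⊗ r_p(τ⁻¹) ⊗ 1)`
on `(X ⊗ X*)⊗²` is an invertible solution of the Yang–Baxter equation, with inverse
`ρ_{τ⁻¹}` (the same formula with `τ` replaced by `τ⁻¹`). -/
theorem statement18
    (hγ : Function.Bijective (HopfAlgebra.antipode (R := K) (A := H)))
    (τi : H ⊗[K] H →ₗ[K] H ⊗[K] H)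
    (hτ1 : τ (K := K) (H := H) ∘ₗ τi = LinearMap.id)
    (hτ2 : τi ∘ₗ τ (K := K) (H := H) = LinearMap.id)
    (u v : H ⊗[K] Module.Dual K H →ₗ[K] Module.Dual K H ⊗[K] H)
    (hu1 : rp (K := K) (τ (K := K) (H := H)) ∘ₗ u = LinearMap.id)
    (hu2 : u ∘ₗ rp (K := K) (τ (K := K) (H := H)) = LinearMap.id)
    (hv1 : rp (K := K) τi ∘ₗ v = LinearMap.id)
    (hv2 : v ∘ₗ rp (K := K) τi = LinearMap.id) :
    (W1 (K := K) (rho (τ (K := K) (H := H)) (rp (K := K) (rp (K := K) (τ (K := K))))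
          (rp (K := K) τi) u) ∘ₗ
        W2 (K := K) (rho (τ (K := K) (H := H)) (rp (K := K) (rp (K := K) (τ (K := K))))
          (rp (K := K) τi) u) ∘ₗ
          W1 (K := K) (rho (τ (K := K) (H := H))
            (rp (K := K) (rp (K := K) (τ (K := K)))) (rp (K := K) τi) u) =
      W2 (K := K) (rho (τ (K := K) (H := H)) (rp (K := K) (rp (K := K) (τ (K := K))))
          (rp (K := K) τi) u) ∘ₗ
        W1 (K := K) (rho (τ (K := K) (H := H)) (rp (K := K) (rp (K := K) (τ (K := K))))
          (rp (K := K) τi) u) ∘ₗ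
          W2 (K := K) (rho (τ (K := K) (H := H))
            (rp (K := K) (rp (K := K) (τ (K := K)))) (rp (K := K) τi) u)) ∧
    (rho (τ (K := K) (H := H)) (rp (K := K) (rp (K := K) (τ (K := K)))) (rp (K := K) τi)
          u ∘ₗ
        rho τi (rp (K := K) (rp (K := K) τi)) (rp (K := K) (τ (K := K) (H := H))) v =
      LinearMap.id) ∧
    (rho τi (rp (K := K) (rp (K := K) τi)) (rp (K := K) (τ (K := K) (H := H))) v ∘ₗ
        rho (τ (K := K) (H := H)) (rp (K := K) (rp (K := K) (τ (K := K))))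
          (rp (K := K) τi) u =
      LinearMap.id) := by
  let e := LinearEquiv.ofBijective (HopfAlgebra.antipode (R := K) (A := H)) hγ
  have h1 : ∀ x, HopfAlgebra.antipode K (e.symm.toLinearMap x) = x := fun x =>
    e.apply_symm_apply x
  have h2 : ∀ x, e.symm.toLinearMap (HopfAlgebra.antipode K x) = x := fun x =>
    e.symm_apply_apply x
  have hu : u = uu e.symm.toLinearMap := by
    rw [← LinearMap.comp_id u, ← rp_tau_uu e.symm.toLinearMap h1 h2, ← LinearMap.comp_assoc, hu2,
      LinearMap.id_comp]
  refine ⟨?_, rho_comp _ _ _ _ _ _ _ _ hτ1 (rprp_comp τ τi hτ2) hv1 hu2,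
    rho_comp _ _ _ _ _ _ _ _ hτ2 (rprp_comp τi τ hτ1) hu1 hv2⟩
  rw [hu, rho_eq e.symm.toLinearMap h1 h2 τi hτ2]
  exact ybe_act e.symm.toLinearMap h1 h2

end Stmt18
end
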